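/- There exists a universal constant C > 0 such that the following holds. Let X be an isotropic log-concave random vector in ℝⁿ and let A = {X ∈ K}, where K is a convex set in ℝⁿ with 0 < P(A) ≤ 1/e. Then for every t ≥ 1, ∑_{i=1}^n E[X_i² 𝟙_{A ∩ {X_i ≥ t}}] ≤ C·P(A)·(σ_X²(−log P(A)) + n·t²·e^{−t/C}). -/

import Mathlib

open MeasureTheory ProbabilityTheory Real
open scoped Pointwise ENNReal RealInnerProductSpace Classical

noncomputable section

variable {Ω : Type*} [MeasurableSpace Ω]

/-- A random vector `X` in `ℝⁿ` is log-concave: for all nonempty compact sets `K, L` and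
`a ∈ [0,1]`, `P(X ∈ aK + (1-a)L) ≥ P(X ∈ K)^a * P(X ∈ L)^(1-a)`. -/
def IsLogConcave {n : ℕ} (μ : Measure Ω) (X : Ω → EuclideanSpace ℝ (Fin n)) : Prop :=
  ∀ K L : Set (EuclideanSpace ℝ (Fin n)), K.Nonempty → L.Nonempty →
    IsCompact K → IsCompact L → ∀ a : ℝ, 0 ≤ a → a ≤ 1 →
      (μ (X ⁻¹' K)).toReal ^ a * (μ (X ⁻¹' L)).toReal ^ (1 - a) ≤
        (μ (X ⁻¹' (a • K + (1 - a) • L))).toReal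

/-- `X` is isotropic: centered with identity covariance matrix. -/
def IsIsotropic {n : ℕ} (μ : Measure Ω) (X : Ω → EuclideanSpace ℝ (Fin n)) : Prop :=
  (∀ i, ∫ ω, X ω i ∂μ = 0) ∧
  ∀ i j, ∫ ω, X ω i * X ω j ∂μ = if i = j then (1 : ℝ) else 0

/-- `σ_X(p) = sup_{|t| = 1} (E|⟨t,X⟩|^p)^(1/p)`. -/
def sigmaX {n : ℕ} (μ : Measure Ω) (X : Ω → EuclideanSpace ℝ (Fin n)) (p : ℝ) : ℝ :=
  ⨆ t : {t : EuclideanSpace ℝ (Fin n) // ‖t‖ = 1},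
    (∫ ω, |⟪t.1, X ω⟫| ^ p ∂μ) ^ (1 / p)

/-- Generalized inverse of `σ_X`. -/
def sigmaXInv {n : ℕ} (μ : Measure Ω) (X : Ω → EuclideanSpace ℝ (Fin n)) (s : ℝ) : ℝ :=
  sSup {p : ℝ | 1 ≤ p ∧ sigmaX μ X p ≤ s}

/-- Log-concavity of a measure, tested on closed sets. -/
def LogConcaveMeasure {E : Type*} [NormedAddCommGroup E] [NormedSpace ℝ E] [MeasurableSpace E]
    (ν : Measure E) : Prop :=
  ∀ K L M : Set E, IsClosed K → IsClosed L → MeasurableSet M → ∀ a : ℝ, 0 < a → a < 1 →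
    (∀ x ∈ K, ∀ y ∈ L, a • x + (1 - a) • y ∈ M) →
      ν.real K ^ a * ν.real L ^ (1 - a) ≤ ν.real M

namespace LogConcaveMeasure

section Basic

variable {E F : Type*} [NormedAddCommGroup E] [NormedSpace ℝ E] [MeasurableSpace E] [BorelSpace E]
  [NormedAddCommGroup F] [NormedSpace ℝ F] {ν : Measure E}

theorem map [MeasurableSpace F] [BorelSpace F] (h : LogConcaveMeasure ν) (T : E →L[ℝ] F) :
    LogConcaveMeasure (ν.map T) := by
  intro K L M hK hL hM a ha ha' hKLM
  have hT : Measurable T := T.continuous.measurable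
  rw [map_measureReal_apply hT hK.measurableSet, map_measureReal_apply hT hL.measurableSet,
    map_measureReal_apply hT hM]
  refine h _ _ _ (hK.preimage T.continuous) (hL.preimage T.continuous) (hT hM) a ha ha' ?_
  intro x hx y hy
  simpa using hKLM _ hx _ hy

theorem restrict (h : LogConcaveMeasure ν) {D : Set E} (hD : IsClosed D) (hconv : Convex ℝ D) :
    LogConcaveMeasure (ν.restrict D) := by
  intro K L M hK hL hM a ha ha' hKLM
  rw [measureReal_restrict_apply hK.measurableSet, measureReal_restrict_apply hL.measurableSet,
    measureReal_restrict_apply hM]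
  refine h _ _ _ (hK.inter hD) (hL.inter hD) (hM.inter hD.measurableSet) a ha ha' ?_
  rintro x ⟨hx, hxD⟩ y ⟨hy, hyD⟩
  exact ⟨hKLM x hx y hy, hconv hxD hyD ha.le (by linarith) (by ring)⟩

theorem real_norm_ge_mul_le [IsFiniteMeasure ν] (h : LogConcaveMeasure ν) (T : E →L[ℝ] F)
    {s ρ : ℝ} (hs : 0 < s) (hρ0 : 0 < ρ) (hρ1 : ρ ≤ 1)
    (hρ : ν.real {x | s ≤ ‖T x‖} ≤ ρ * ν.real {x | ‖T x‖ ≤ s}) {t : ℝ} (ht : 1 ≤ t) :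
    ν.real {x | t * s ≤ ‖T x‖} ≤ ρ ^ (t / 2) * ν.real Set.univ := by
  have hc : Continuous fun x => ‖T x‖ := T.continuous.norm
  set N := ν.real {x | ‖T x‖ ≤ s}
  have hN : N ≤ ν.real Set.univ := measureReal_mono (Set.subset_univ _)
  have hN0 : 0 ≤ N := measureReal_nonneg
  rcases eq_or_lt_of_le ht with rfl | ht1
  · rw [one_mul]
    refine hρ.trans (mul_le_mul ?_ hN hN0 (by positivity))
    calc ρ = ρ ^ (1 : ℝ) := (Real.rpow_one _).symm
      _ ≤ ρ ^ ((1 : ℝ) / 2) := Real.rpow_le_rpow_of_exponent_ge hρ0 hρ1 (by norm_num)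
  set P := ν.real {x | t * s ≤ ‖T x‖}
  have hP0 : 0 ≤ P := measureReal_nonneg
  have key : P ^ (2 / (t + 1)) * N ^ (1 - 2 / (t + 1)) ≤ ρ * N := by
    refine le_trans ?_ hρ
    refine h _ _ _ (isClosed_le continuous_const hc) (isClosed_le hc continuous_const)
      (isClosed_le continuous_const hc).measurableSet _ (by positivity)
      (by rw [div_lt_one (by positivity)]; linarith) ?_
    intro x hx y hy
    simp only [Set.mem_ofPred_eq, map_add, map_smul] at hx hy ⊢
    have h1 : 0 ≤ 1 - 2 / (t + 1) := by
      rw [sub_nonneg, div_le_one (by positivity)]; linarith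
    have := norm_sub_le_norm_add ((2 / (t + 1)) • T x) ((1 - 2 / (t + 1)) • T y)
    rw [norm_smul, norm_smul, Real.norm_of_nonneg h1,
      Real.norm_of_nonneg (show 0 ≤ 2 / (t + 1) by positivity)] at this
    have h2 : (2 / (t + 1)) * (t * s) ≤ (2 / (t + 1)) * ‖T x‖ := by gcongr
    have h3 : (1 - 2 / (t + 1)) * ‖T y‖ ≤ (1 - 2 / (t + 1)) * s := by gcongr
    have h4 : (2 / (t + 1)) * (t * s) - (1 - 2 / (t + 1)) * s = s := by field_simp; ring
    linarith
  rcases eq_or_lt_of_le hN0 with hN0' | hNpos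
  · have hPs : P ≤ ν.real {x | s ≤ ‖T x‖} := by
      refine measureReal_mono fun x hx => ?_
      simp only [Set.mem_ofPred_eq] at hx ⊢
      nlinarith
    rw [← hN0', mul_zero] at hρ
    have : P ≤ 0 := hPs.trans hρ
    exact this.trans (by positivity)
  have key2 : P ^ (2 / (t + 1)) ≤ ρ * N ^ (2 / (t + 1)) := by
    rw [Real.rpow_sub hNpos, Real.rpow_one, mul_div_assoc', div_le_iff₀ (by positivity)] at key
    have : N * P ^ (2 / (t + 1)) ≤ N * (ρ * N ^ (2 / (t + 1))) := by linarith
    exact le_of_mul_le_mul_left this hNpos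
  have key3 : P ≤ ρ ^ ((t + 1) / 2) * N := by
    have := Real.rpow_le_rpow (by positivity) key2 (show 0 ≤ (t + 1) / 2 by positivity)
    rw [Real.mul_rpow hρ0.le (by positivity), ← Real.rpow_mul hP0, ← Real.rpow_mul hN0,
      show 2 / (t + 1) * ((t + 1) / 2) = 1 by field_simp, Real.rpow_one, Real.rpow_one] at this
    exact this
  refine key3.trans (mul_le_mul ?_ hN hN0 (by positivity))
  exact Real.rpow_le_rpow_of_exponent_ge hρ0 hρ1 (by linarith)

theorem measure_frontier_eq_zero_of_interior_pos [IsFiniteMeasure ν] (h : LogConcaveMeasure ν)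
    {K : Set E} (hK : Convex ℝ K) (hpos : 0 < ν (interior K)) : ν (frontier K) = 0 := by
  obtain ⟨L, hLK, hL, hLpos⟩ := isOpen_interior.exists_lt_isClosed hpos
  have hN : 0 < ν.real L := ENNReal.toReal_pos hLpos.ne' (measure_ne_top _ _)
  have key : ∀ θ ∈ Set.Ioo (0 : ℝ) 1,
      ν.real (closure K) ^ (1 - θ) * ν.real L ^ θ ≤ ν.real (interior K) := by
    rintro θ ⟨h0, h1⟩
    have := h (closure K) L (interior K) isClosed_closure hL isOpen_interior.measurableSet (1 - θ)
      (by linarith) (by linarith) (fun x hx y hy =>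
        hK.combo_closure_interior_subset_interior (by linarith) (by linarith) (by ring)
          (Set.add_mem_add (Set.smul_mem_smul_set hx) (Set.smul_mem_smul_set (hLK hy))))
    simpa using this
  have hKpos : 0 < ν.real (closure K) :=
    hN.trans_le (measureReal_mono (hLK.trans (interior_subset.trans subset_closure)))
  have hlim : Filter.Tendsto (fun θ : ℝ => ν.real (closure K) ^ (1 - θ) * ν.real L ^ θ)
      (nhdsWithin 0 (Set.Ioi 0)) (nhds (ν.real (closure K))) := by
    have hcont : Continuous fun θ : ℝ => ν.real (closure K) ^ (1 - θ) * ν.real L ^ θ :=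
      (continuous_const.rpow (by fun_prop) (fun _ => Or.inl hKpos.ne')).mul
        (continuous_const.rpow continuous_id (fun _ => Or.inl hN.ne'))
    have := (hcont.tendsto 0).mono_left (nhdsWithin_le_nhds (s := Set.Ioi 0))
    simpa using this
  have hle : ν.real (closure K) ≤ ν.real (interior K) := by
    refine le_of_tendsto hlim ?_
    filter_upwards [Ioo_mem_nhdsGT (show (0 : ℝ) < 1 by norm_num)] with θ hθ using key θ hθ
  rw [frontier, ← measureReal_eq_zero_iff, measureReal_sdiff
    (interior_subset.trans subset_closure) isOpen_interior.measurableSet]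
  linarith [measureReal_mono (μ := ν) (interior_subset.trans (subset_closure (s := K)))]

theorem measure_hyperplane_eq_zero [IsFiniteMeasure ν] (h : LogConcaveMeasure ν)
    (hnd : ∀ (f : E →L[ℝ] ℝ) (c : ℝ), f ≠ 0 → ν {x | f x ≠ c} ≠ 0) (f : E →L[ℝ] ℝ) (c : ℝ)
    (hf : f ≠ 0) : ν {x | f x = c} = 0 := by
  have main : ∀ (g : E →L[ℝ] ℝ) (d : ℝ), g ≠ 0 → ν {x | d < g x} ≠ 0 → ν {x | g x = d} = 0 := by
    intro g d hg hpos
    have hopen : IsOpenMap g := g.isOpenMap_of_ne_zero hg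
    have hfr := h.measure_frontier_eq_zero_of_interior_pos (K := g ⁻¹' Set.Ici d)
      ((convex_Ici d).linear_preimage (g : E →ₗ[ℝ] ℝ)) (by
        rw [← hopen.preimage_interior_eq_interior_preimage g.continuous, interior_Ici]
        exact pos_iff_ne_zero.2 hpos)
    rw [← hopen.preimage_frontier_eq_frontier_preimage g.continuous, frontier_Ici] at hfr
    exact hfr
  by_cases h1 : ν {x | c < f x} = 0
  · have h2 : ν {x | -c < (-f) x} ≠ 0 := by
      intro h2
      refine hnd f c hf (measure_mono_null ?_ (measure_union_null h1 h2))
      intro x hx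
      rcases lt_or_gt_of_ne hx with h3 | h3
      · right; simpa using h3
      · left; exact h3
    have := main (-f) (-c) (neg_ne_zero.2 hf) h2
    simpa using this
  · exact main f c hf h1

theorem convex_support (h : LogConcaveMeasure ν) [IsFiniteMeasure ν] : Convex ℝ ν.support := by
  rw [convex_iff_forall_pos]
  intro x hx y hy a b ha hb hab
  obtain rfl : b = 1 - a := by linarith
  rw [Metric.nhds_basis_closedBall.mem_measureSupport] at hx hy ⊢
  intro r hr
  have hxr := ENNReal.toReal_pos (hx r hr).ne' (measure_ne_top _ _)
  have hyr := ENNReal.toReal_pos (hy r hr).ne' (measure_ne_top _ _)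
  have := h _ _ (Metric.closedBall (a • x + (1 - a) • y) r) (Metric.isClosed_closedBall (x := x) (ε := r))
    (Metric.isClosed_closedBall (x := y) (ε := r)) Metric.isClosed_closedBall.measurableSet a ha
    (by linarith) (by
      intro u hu v hv
      rw [mem_closedBall_iff_norm] at hu hv ⊢
      calc ‖a • u + (1 - a) • v - (a • x + (1 - a) • y)‖
          = ‖a • (u - x) + (1 - a) • (v - y)‖ := by congr 1; module
        _ ≤ a * ‖u - x‖ + (1 - a) * ‖v - y‖ := by
          refine (norm_add_le _ _).trans_eq ?_
          rw [norm_smul, norm_smul, Real.norm_of_nonneg ha.le, Real.norm_of_nonneg hb.le]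
        _ ≤ a * r + (1 - a) * r := by gcongr
        _ = r := by ring)
  have hpos : 0 < ν.real (Metric.closedBall (a • x + (1 - a) • y) r) :=
    lt_of_lt_of_le (mul_pos (Real.rpow_pos_of_pos hxr _) (Real.rpow_pos_of_pos hyr _)) this
  exact (ENNReal.toReal_pos_iff.1 hpos).1

theorem measure_frontier_eq_zero [FiniteDimensional ℝ E] [IsFiniteMeasure ν]
    (h : LogConcaveMeasure ν)
    (hnd : ∀ (f : E →L[ℝ] ℝ) (c : ℝ), f ≠ 0 → ν {x | f x ≠ c} ≠ 0) {K : Set E}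
    (hK : Convex ℝ K) : ν (frontier K) = 0 := by
  have hsupp : ν (ν.support)ᶜ = 0 := Measure.measure_compl_support
  by_cases hint : interior K = ∅
  · rcases K.eq_empty_or_nonempty with rfl | ⟨x₀, hx₀⟩
    · simp
    have hspan : affineSpan ℝ K ≠ ⊤ := by
      intro htop
      rw [← hK.interior_nonempty_iff_affineSpan_eq_top, hint] at htop
      exact Set.not_nonempty_empty htop
    have hdir : (affineSpan ℝ K).direction < ⊤ := by
      refine lt_top_iff_ne_top.2 fun htop => hspan ?_
      exact (AffineSubspace.direction_eq_top_iff_of_nonempty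
        ⟨x₀, subset_affineSpan ℝ K hx₀⟩).1 htop
    obtain ⟨g, hg0, hg⟩ := Submodule.exists_le_ker_of_lt_top _ hdir
    have hf0 : LinearMap.toContinuousLinearMap g ≠ 0 := by
      simpa using hg0
    refine measure_mono_null ?_ (h.measure_hyperplane_eq_zero hnd
      (LinearMap.toContinuousLinearMap g) (g x₀) hf0)
    refine frontier_subset_closure.trans (closure_minimal ?_ ?_)
    · intro x hx
      have := hg (AffineSubspace.vsub_mem_direction (subset_affineSpan ℝ K hx)
        (subset_affineSpan ℝ K hx₀))
      simpa [sub_eq_zero] using this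
    · exact isClosed_eq (LinearMap.toContinuousLinearMap g).continuous continuous_const
  by_cases hpos : ν (interior K) = 0
  · have hdisj : Disjoint (interior K) ν.support := by
      rw [Set.disjoint_left]
      intro x hx hxs
      rw [Measure.mem_support_iff_forall] at hxs
      exact (hxs _ (isOpen_interior.mem_nhds hx)).ne' hpos
    obtain ⟨f, u, hfu, huf⟩ := geometric_hahn_banach_open hK.interior isOpen_interior
      h.convex_support hdisj
    rcases eq_or_ne ν 0 with rfl | hν
    · simp
    obtain ⟨x₀, hx₀⟩ := Set.nonempty_iff_ne_empty.2 hint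
    obtain ⟨y₀, hy₀⟩ := Measure.nonempty_support hν
    have hf : f ≠ 0 := by
      rintro rfl
      have h1 := hfu x₀ hx₀
      have h2 := huf y₀ hy₀
      simp only [zero_apply] at h1 h2
      linarith
    refine measure_mono_null ?_ (measure_union_null hsupp (h.measure_hyperplane_eq_zero hnd f u hf))
    intro x hx
    by_cases hxs : x ∈ ν.support
    · right
      refine le_antisymm ?_ (huf x hxs)
      have hcl : x ∈ closure (interior K) := by
        rw [hK.closure_interior_eq_closure_of_nonempty_interior ⟨x₀, hx₀⟩]
        exact frontier_subset_closure hx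
      exact closure_minimal (fun z hz => (hfu z hz).le)
        (isClosed_le f.continuous continuous_const) hcl
    · left; exact hxs
  · exact h.measure_frontier_eq_zero_of_interior_pos hK (pos_iff_ne_zero.2 hpos)

end Basic

/-- The points around which a log-concave measure in dimension `k` gives little mass to a ball
form a set of small measure. -/
theorem real_setOf_real_closedBall_le {F : Type*} [NormedAddCommGroup F]
    [NormedSpace ℝ F]
    [FiniteDimensional ℝ F] [MeasurableSpace F] [BorelSpace F] {τ : Measure F}
    [IsProbabilityMeasure τ] (h : LogConcaveMeasure τ) {r δ : ℝ} (hr : 0 < r)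
    (hball : 1 / 2 ≤ τ.real (Metric.closedBall 0 r)) :
    MeasurableSet {z | τ.real (Metric.closedBall z (2 * r)) ≤ δ} ∧
    τ.real {z | τ.real (Metric.closedBall z (2 * r)) ≤ δ} ≤
      2 ^ Module.finrank ℝ F * √(2 * δ) := by
  set bad : Set F := {z | τ.real (Metric.closedBall z (2 * r)) ≤ δ} with hbad
  have hbadm : MeasurableSet bad := by
    have hm : MeasurableSet {q : F × F | dist q.2 q.1 ≤ 2 * r} :=
      (isClosed_le (by fun_prop) continuous_const).measurableSet
    have := (measurable_measure_prodMk_left (ν := τ) hm).ennreal_toReal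
    exact measurableSet_le this measurable_const
  refine ⟨hbadm, ?_⟩
  let lam : Measure F := Measure.addHaar
  have hpt : ∀ w : F, τ (bad ∩ Metric.closedBall w r) ≤
      ENNReal.ofReal √(2 * δ) * τ (Metric.closedBall ((1 / 2 : ℝ) • w) r) := by
    intro w
    rcases (bad ∩ Metric.closedBall w r).eq_empty_or_nonempty with he | ⟨z, hz, hzw⟩
    · simp [he]
    refine (measure_mono Set.inter_subset_right).trans ?_
    rw [← ofReal_measureReal, ← ofReal_measureReal, ← ENNReal.ofReal_mul (by positivity)]
    refine ENNReal.ofReal_le_ofReal ?_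
    set T := τ.real (Metric.closedBall w r)
    set S := τ.real (Metric.closedBall ((1 / 2 : ℝ) • w) r)
    have hT0 : 0 ≤ T := measureReal_nonneg
    have hTδ : T ≤ δ := by
      refine le_trans (measureReal_mono ?_) hz
      intro v hv
      rw [Metric.mem_closedBall] at hv hzw ⊢
      have := dist_triangle v w z
      rw [dist_comm w z] at this
      linarith
    have h1 : √T * √(1 / 2) ≤ S := by
      have h2 := h (Metric.closedBall w r) (Metric.closedBall 0 r)
        (Metric.closedBall ((1 / 2 : ℝ) • w) r) Metric.isClosed_closedBall
        Metric.isClosed_closedBall Metric.isClosed_closedBall.measurableSet (1 / 2) (by norm_num)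
        (by norm_num) (by
          intro x hx y hy
          rw [mem_closedBall_iff_norm] at hx hy ⊢
          calc ‖(1 / 2 : ℝ) • x + (1 - 1 / 2 : ℝ) • y - (1 / 2 : ℝ) • w‖
              = ‖(1 / 2 : ℝ) • (x - w) + (1 / 2 : ℝ) • (y - 0)‖ := by congr 1; module
            _ ≤ 1 / 2 * ‖x - w‖ + 1 / 2 * ‖y - 0‖ := by
              refine (norm_add_le _ _).trans_eq ?_
              rw [norm_smul, norm_smul]; norm_num
            _ ≤ r := by linarith)
      rw [show (1 - 1 / 2 : ℝ) = 1 / 2 by norm_num, ← Real.sqrt_eq_rpow, ← Real.sqrt_eq_rpow] at h2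
      refine le_trans ?_ h2
      gcongr
    have h3 : √(1 / 2) * √2 = 1 := by
      rw [← Real.sqrt_mul (by norm_num)]; norm_num
    have h4 : √T ≤ √2 * S := by
      calc √T = √2 * (√T * √(1 / 2)) := by rw [mul_left_comm, mul_comm √2, h3, mul_one]
        _ ≤ √2 * S := by gcongr
    calc T = √T * √T := (Real.mul_self_sqrt hT0).symm
      _ ≤ √δ * (√2 * S) := by gcongr
      _ = √(2 * δ) * S := by rw [Real.sqrt_mul (by norm_num)]; ring
  have hA : MeasurableSet {q : F × F | q.2 ∈ bad ∧ dist q.2 q.1 ≤ r} := by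
    have hd : MeasurableSet {q : F × F | dist q.2 q.1 ≤ r} :=
      (isClosed_le (by fun_prop) continuous_const).measurableSet
    exact (measurable_snd hbadm).inter hd
  have hB : MeasurableSet {q : F × F | dist q.2 ((1 / 2 : ℝ) • q.1) ≤ r} :=
    (isClosed_le (by fun_prop) continuous_const).measurableSet
  have hA1 : (lam.prod τ) {q : F × F | q.2 ∈ bad ∧ dist q.2 q.1 ≤ r} =
      lam (Metric.closedBall 0 r) * τ bad := by
    rw [Measure.prod_apply_symm hA, ← setLIntegral_const, ← lintegral_indicator hbadm]
    refine lintegral_congr fun z => ?_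
    by_cases hz : z ∈ bad
    · rw [Set.indicator_of_mem hz, ← Measure.addHaar_closedBall_center lam z r]
      congr 1
      ext w
      simp [hz, dist_comm]
    · rw [Set.indicator_of_notMem hz]
      convert measure_empty (μ := lam)
      ext w
      simp [hz]
  have hB1 : (lam.prod τ) {q : F × F | dist q.2 ((1 / 2 : ℝ) • q.1) ≤ r} =
      ENNReal.ofReal (2 ^ Module.finrank ℝ F) * lam (Metric.closedBall 0 r) := by
    rw [Measure.prod_apply_symm hB, ← Measure.addHaar_closedBall_mul lam 0 (by norm_num) hr.le]
    have : ∀ z : F, lam ((fun x => (x, z)) ⁻¹' {q : F × F | dist q.2 ((1 / 2 : ℝ) • q.1) ≤ r}) =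
        lam (Metric.closedBall 0 (2 * r)) := by
      intro z
      rw [← Measure.addHaar_closedBall_center lam ((2 : ℝ) • z)]
      congr 1
      ext w
      simp only [Set.mem_preimage, Set.mem_ofPred_eq, Metric.mem_closedBall]
      rw [show w = (2 : ℝ) • ((1 / 2 : ℝ) • w) by module, dist_smul₀]
      rw [show (1 / 2 : ℝ) • (2 : ℝ) • (1 / 2 : ℝ) • w = (1 / 2 : ℝ) • w by module, dist_comm]
      norm_num
    rw [lintegral_congr this, lintegral_const, measure_univ, mul_one]
  have hle : (lam.prod τ) {q : F × F | q.2 ∈ bad ∧ dist q.2 q.1 ≤ r} ≤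
      ENNReal.ofReal √(2 * δ) * (lam.prod τ) {q : F × F | dist q.2 ((1 / 2 : ℝ) • q.1) ≤ r} := by
    rw [Measure.prod_apply hA, Measure.prod_apply hB, ← lintegral_const_mul _
      (measurable_measure_prodMk_left hB)]
    exact lintegral_mono fun w => hpt w
  rw [hA1, hB1] at hle
  have hl0 : lam (Metric.closedBall 0 r) ≠ 0 := (Metric.measure_closedBall_pos _ _ hr).ne'
  have hl1 : lam (Metric.closedBall 0 r) ≠ ⊤ := measure_closedBall_lt_top.ne
  have hfin : τ bad ≤ ENNReal.ofReal (2 ^ Module.finrank ℝ F * √(2 * δ)) := by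
    rw [← ENNReal.mul_le_mul_iff_right hl0 hl1, ENNReal.ofReal_mul (by positivity)]
    refine hle.trans_eq ?_
    ring
  exact ENNReal.toReal_le_of_le_ofReal (by positivity) hfin

end LogConcaveMeasure

section GaussianProjection

variable {E : Type*} [NormedAddCommGroup E] [InnerProductSpace ℝ E]

/-- The linear map `x ↦ (⟪Γ j, x⟫)_j` with rows `Γ j`. -/
def rowsMap {k : ℕ} (Γ : Fin k → E) : E →L[ℝ] EuclideanSpace ℝ (Fin k) :=
  (EuclideanSpace.equiv (Fin k) ℝ).symm.toContinuousLinearMap ∘L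
    ContinuousLinearMap.pi fun j => innerSL ℝ (Γ j)

theorem norm_rowsMap_sq {k : ℕ} (Γ : Fin k → E) (x : E) :
    ‖rowsMap Γ x‖ ^ 2 = ∑ j, ⟪Γ j, x⟫ ^ 2 := by
  rw [EuclideanSpace.norm_sq_eq]
  simp [rowsMap]

theorem continuous_norm_rowsMap {Y : Type*} [TopologicalSpace Y] {k : ℕ} {f : Y → Fin k → E}
    {g : Y → E} (hf : Continuous f) (hg : Continuous g) :
    Continuous fun y => ‖rowsMap (f y) (g y)‖ := by
  have : (fun y => ‖rowsMap (f y) (g y)‖) = fun y => √(∑ j, ⟪f y j, g y⟫ ^ 2) := by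
    ext y
    rw [← norm_rowsMap_sq, Real.sqrt_sq (norm_nonneg _)]
  rw [this]
  fun_prop

variable [FiniteDimensional ℝ E] [MeasurableSpace E] [BorelSpace E]

theorem map_inner_stdGaussian (v : E) :
    (stdGaussian E).map (fun g => ⟪g, v⟫) = gaussianReal 0 (‖v‖ ^ 2).toNNReal := by
  have h := IsGaussian.map_eq_gaussianReal (μ := stdGaussian E) (innerSL ℝ v)
  rw [integral_strongDual_stdGaussian, variance_dual_stdGaussian, innerSL_apply_norm] at h
  rw [← h]
  congr 1
  ext g
  simp [real_inner_comm]

theorem integral_inner_sq_stdGaussian (v : E) : ∫ g, ⟪g, v⟫ ^ 2 ∂(stdGaussian E) = ‖v‖ ^ 2 := by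
  have h := variance_id_gaussianReal (μ := 0) (v := (‖v‖ ^ 2).toNNReal)
  rw [variance_of_integral_eq_zero (by fun_prop) (by simp), ← map_inner_stdGaussian v,
    integral_map (by fun_prop) (by fun_prop)] at h
  simpa using h

theorem integrable_inner_sq_stdGaussian (v : E) :
    Integrable (fun g => ⟪g, v⟫ ^ 2) (stdGaussian E) := by
  rcases eq_or_ne v 0 with rfl | hv
  · simp
  · refine Integrable.of_integral_ne_zero ?_
    rw [integral_inner_sq_stdGaussian]
    simpa using hv

theorem integral_exp_neg_mul_sq_gaussianReal {v : NNReal} (hv : v ≠ 0) {c : ℝ} (hc : 0 ≤ c) :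
    ∫ x, Real.exp (-c * x ^ 2) ∂(gaussianReal 0 v) = √(1 / (1 + 2 * c * v)) := by
  have hv' : (0 : ℝ) < v := lt_of_le_of_ne v.2 (by exact_mod_cast hv.symm)
  rw [integral_gaussianReal_eq_integral_smul hv]
  have : ∀ x : ℝ, gaussianPDFReal 0 v x • Real.exp (-c * x ^ 2) =
      (√(2 * π * v))⁻¹ * Real.exp (-(c + 1 / (2 * v)) * x ^ 2) := by
    intro x
    rw [gaussianPDFReal, smul_eq_mul, mul_assoc, ← Real.exp_add]
    congr 2
    field_simp
    ring
  simp_rw [this]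
  rw [integral_const_mul, integral_gaussian, ← Real.sqrt_inv, ← Real.sqrt_mul (by positivity)]
  congr 1
  field_simp
  ring

theorem integral_exp_neg_mul_inner_sq_stdGaussian (v : E) {c : ℝ} (hc : 0 ≤ c) :
    ∫ g, Real.exp (-c * ⟪g, v⟫ ^ 2) ∂(stdGaussian E) = √(1 / (1 + 2 * c * ‖v‖ ^ 2)) := by
  rcases eq_or_ne v 0 with rfl | hv
  · simp
  have h := integral_exp_neg_mul_sq_gaussianReal (v := (‖v‖ ^ 2).toNNReal) (by simpa using hv) hc
  rw [← map_inner_stdGaussian v, integral_map (by fun_prop) (by fun_prop)] at h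
  simpa using h

/-- The law of a `k`-tuple of independent standard Gaussian vectors. -/
def gaussianRows (E : Type*) [NormedAddCommGroup E] [InnerProductSpace ℝ E] [FiniteDimensional ℝ E]
    [MeasurableSpace E] [BorelSpace E] (k : ℕ) : Measure (Fin k → E) :=
  Measure.pi fun _ => stdGaussian E

instance (k : ℕ) : IsProbabilityMeasure (gaussianRows E k) := by
  unfold gaussianRows; infer_instance

theorem integral_norm_rowsMap_sq (k : ℕ) (x : E) :
    Integrable (fun Γ => ‖rowsMap Γ x‖ ^ 2) (gaussianRows E k) ∧
      ∫ Γ, ‖rowsMap Γ x‖ ^ 2 ∂(gaussianRows E k) = k * ‖x‖ ^ 2 := by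
  simp_rw [norm_rowsMap_sq]
  have hmp : ∀ j : Fin k, MeasurePreserving (Function.eval j) (gaussianRows E k) (stdGaussian E) :=
    fun j => measurePreserving_eval _ j
  have hint : ∀ j : Fin k, Integrable (fun Γ : Fin k → E => ⟪Γ j, x⟫ ^ 2) (gaussianRows E k) :=
    fun j => (hmp j).integrable_comp_of_integrable (integrable_inner_sq_stdGaussian x)
  refine ⟨integrable_finsetSum _ fun j _ => hint j, ?_⟩
  rw [integral_finsetSum _ fun j _ => hint j]
  have : ∀ j : Fin k, ∫ Γ : Fin k → E, ⟪Γ j, x⟫ ^ 2 ∂(gaussianRows E k) = ‖x‖ ^ 2 := by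
    intro j
    rw [← integral_inner_sq_stdGaussian x, ← (hmp j).map_eq,
      integral_map (measurable_pi_apply j).aemeasurable (by fun_prop)]
  simp [this]

/-- Small ball estimate for a Gaussian projection. -/
theorem gaussianRows_real_norm_rowsMap_le (k : ℕ) (v : E) (ρ : ℝ) {c : ℝ} (hc : 0 ≤ c) :
    (gaussianRows E k).real {Γ | ‖rowsMap Γ v‖ ≤ ρ} ≤
      Real.exp (c * ρ ^ 2) * √(1 / (1 + 2 * c * ‖v‖ ^ 2)) ^ k := by
  have hprod : ∀ Γ : Fin k → E, Real.exp (-c * ‖rowsMap Γ v‖ ^ 2) =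
      ∏ j, Real.exp (-c * ⟪Γ j, v⟫ ^ 2) := by
    intro Γ
    rw [← Real.exp_sum, norm_rowsMap_sq, Finset.mul_sum]
  have hcont : Continuous fun Γ : Fin k → E => ‖rowsMap Γ v‖ :=
    continuous_norm_rowsMap continuous_id continuous_const
  have hint : Integrable (fun Γ => Real.exp (-c * ‖rowsMap Γ v‖ ^ 2)) (gaussianRows E k) := by
    refine Integrable.of_bound (C := 1)
      (Real.continuous_exp.comp (continuous_const.mul (hcont.pow 2))).aestronglyMeasurable
      (Filter.Eventually.of_forall fun Γ => ?_)
    rw [Real.norm_of_nonneg (Real.exp_pos _).le, Real.exp_le_one_iff]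
    nlinarith [mul_nonneg hc (sq_nonneg ‖rowsMap Γ v‖)]
  have hI : ∫ Γ, Real.exp (-c * ‖rowsMap Γ v‖ ^ 2) ∂(gaussianRows E k) =
      √(1 / (1 + 2 * c * ‖v‖ ^ 2)) ^ k := by
    simp_rw [hprod]
    rw [gaussianRows, integral_fintype_prod_eq_pow (fun g : E => Real.exp (-c * ⟪g, v⟫ ^ 2)),
      integral_exp_neg_mul_inner_sq_stdGaussian v hc, Fintype.card_fin]
  have hmk := mul_meas_ge_le_integral_of_nonneg (μ := gaussianRows E k)
    (Filter.Eventually.of_forall fun Γ => (Real.exp_pos (-c * ‖rowsMap Γ v‖ ^ 2)).le) hint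
    (Real.exp (-c * ρ ^ 2))
  rw [hI] at hmk
  have hsub : (gaussianRows E k).real {Γ | ‖rowsMap Γ v‖ ≤ ρ} ≤
      (gaussianRows E k).real {Γ | Real.exp (-c * ρ ^ 2) ≤ Real.exp (-c * ‖rowsMap Γ v‖ ^ 2)} := by
    refine measureReal_mono fun Γ hΓ => ?_
    simp only [Set.mem_ofPred_eq] at hΓ ⊢
    rw [Real.exp_le_exp]
    have : ‖rowsMap Γ v‖ ^ 2 ≤ ρ ^ 2 := by gcongr
    nlinarith
  calc _ ≤ _ := hsub
    _ = Real.exp (c * ρ ^ 2) * (Real.exp (-c * ρ ^ 2) * (gaussianRows E k).real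
        {Γ | Real.exp (-c * ρ ^ 2) ≤ Real.exp (-c * ‖rowsMap Γ v‖ ^ 2)}) := by
      rw [← mul_assoc, ← Real.exp_add]; simp
    _ ≤ _ := by gcongr

end GaussianProjection

namespace LogConcaveMeasure

section SmallBall

variable {E : Type*} [NormedAddCommGroup E] [InnerProductSpace ℝ E] [FiniteDimensional ℝ E]
  [MeasurableSpace E] [BorelSpace E] {ν : Measure E} [IsProbabilityMeasure ν]

theorem le_prod_norm_sub_le (h : LogConcaveMeasure ν) {k : ℕ} (T : E →L[ℝ] EuclideanSpace ℝ (Fin k))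
    {r : ℝ} (hr : 0 < r) (hball : 1 / 2 ≤ ν.real {x | ‖T x‖ ≤ r}) {A : Set E}
    (hA : MeasurableSet A) (hAk : Real.exp (-k) ≤ ν.real A) :
    ENNReal.ofReal ((1 / 16) * (1 / 36) ^ k * ν.real A) ≤
      (ν.prod ν) {q | q.1 ∈ A ∧ ‖T (q.1 - q.2)‖ ≤ 2 * r} := by
  have hT : Measurable T := T.continuous.measurable
  set δ : ℝ := (1 / 8) * (1 / 36) ^ k with hδ
  have hprob : IsProbabilityMeasure (ν.map T) := Measure.isProbabilityMeasure_map hT.aemeasurable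
  obtain ⟨hbm, hb⟩ := (h.map T).real_setOf_real_closedBall_le (δ := δ) hr (by
    rw [map_measureReal_apply hT Metric.isClosed_closedBall.measurableSet]
    convert hball using 2
    ext x; simp)
  set bad : Set (EuclideanSpace ℝ (Fin k)) :=
    {z | (ν.map T).real (Metric.closedBall z (2 * r)) ≤ δ}
  have hbad : ν.real (T ⁻¹' bad) ≤ ν.real A / 2 := by
    rw [← map_measureReal_apply hT hbm]
    refine hb.trans ?_
    have h2δ : √(2 * δ) = 1 / 2 * (1 / 6) ^ k := by
      rw [show 2 * δ = (1 / 2 * (1 / 6) ^ k) ^ 2 by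
        rw [hδ, mul_pow, ← pow_mul, mul_comm k 2, pow_mul]; norm_num; ring]
      exact Real.sqrt_sq (by positivity)
    have h3 : ((1 : ℝ) / 3) ^ k ≤ Real.exp (-k) := by
      rw [show (-(k : ℝ)) = k * (-1) by ring, Real.exp_nat_mul]
      gcongr
      rw [Real.exp_neg, one_div]
      exact inv_anti₀ (Real.exp_pos _) Real.exp_one_lt_three.le
    rw [h2δ, finrank_euclideanSpace_fin]
    calc (2 : ℝ) ^ k * (1 / 2 * (1 / 6) ^ k) = (1 / 3) ^ k / 2 := by
          rw [show (1 / 3 : ℝ) = 2 * (1 / 6) by norm_num, mul_pow]; ring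
      _ ≤ ν.real A / 2 := by linarith
  have hS : MeasurableSet {q : E × E | q.1 ∈ A ∧ ‖T (q.1 - q.2)‖ ≤ 2 * r} := by
    have hd : MeasurableSet {q : E × E | ‖T (q.1 - q.2)‖ ≤ 2 * r} :=
      (isClosed_le (by fun_prop) continuous_const).measurableSet
    exact (measurable_fst hA).inter hd
  have hgood : ν.real A / 2 ≤ ν.real (A \ T ⁻¹' bad) := by
    have := measureReal_sdiff_add_inter (μ := ν) (s := A) (hT hbm)
    have h2 : ν.real (A ∩ T ⁻¹' bad) ≤ ν.real (T ⁻¹' bad) := measureReal_mono Set.inter_subset_right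
    linarith
  have hδ0 : 0 ≤ δ := by positivity
  calc ENNReal.ofReal ((1 / 16) * (1 / 36) ^ k * ν.real A)
      ≤ ENNReal.ofReal (δ * ν.real (A \ T ⁻¹' bad)) := by
        refine ENNReal.ofReal_le_ofReal ?_
        calc (1 / 16) * (1 / 36) ^ k * ν.real A = δ * (ν.real A / 2) := by rw [hδ]; ring
          _ ≤ _ := by gcongr
    _ = ∫⁻ _ in A \ T ⁻¹' bad, ENNReal.ofReal δ ∂ν := by
        rw [setLIntegral_const, ENNReal.ofReal_mul hδ0, ofReal_measureReal]
    _ ≤ ∫⁻ x in A \ T ⁻¹' bad,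
          ν (Prod.mk x ⁻¹' {q : E × E | q.1 ∈ A ∧ ‖T (q.1 - q.2)‖ ≤ 2 * r}) ∂ν := by
        refine setLIntegral_mono' (hA.diff (hT hbm)) fun x hx => ?_
        have hx2 : δ < (ν.map T).real (Metric.closedBall (T x) (2 * r)) := not_le.1 hx.2
        rw [map_measureReal_apply hT Metric.isClosed_closedBall.measurableSet] at hx2
        refine (ENNReal.ofReal_le_ofReal hx2.le).trans ?_
        rw [ofReal_measureReal]
        refine measure_mono fun y hy => ?_
        rw [Set.mem_preimage, Metric.mem_closedBall, dist_comm, dist_eq_norm, ← map_sub] at hy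
        exact ⟨hx.1, hy⟩
    _ ≤ ∫⁻ x, ν (Prod.mk x ⁻¹' {q : E × E | q.1 ∈ A ∧ ‖T (q.1 - q.2)‖ ≤ 2 * r}) ∂ν :=
        setLIntegral_le_lintegral _ _
    _ = _ := (Measure.prod_apply hS).symm

theorem half_le_gaussianRows_setOf {m : ℝ} (hm : 0 < m)
    (hint : Integrable (fun x => ‖x‖ ^ 2) ν) (hmom : ∫ x, ‖x‖ ^ 2 ∂ν ≤ m) {k : ℕ} (hk : 1 ≤ k) :
    ∃ G : Set (Fin k → E), MeasurableSet G ∧ 1 / 2 ≤ (gaussianRows E k).real G ∧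
      ∀ Γ ∈ G, 1 / 2 ≤ ν.real {x | ‖rowsMap Γ x‖ ≤ 2 * √(k * m)} := by
  have hk0 : (0 : ℝ) < k := by exact_mod_cast hk
  set r := 2 * √(k * m) with hr
  have hr2 : r ^ 2 = 4 * (k * m) := by
    rw [hr, mul_pow, Real.sq_sqrt (by positivity)]; norm_num
  have hr0 : 0 < r := by positivity
  have hS : MeasurableSet {q : (Fin k → E) × E | r < ‖rowsMap q.1 q.2‖} :=
    (isOpen_lt continuous_const (continuous_norm_rowsMap continuous_fst continuous_snd)).measurableSet
  have hmeas := measurable_measure_prodMk_left (ν := ν) hS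
  set φ : (Fin k → E) → ℝ≥0∞ :=
    fun Γ => ν (Prod.mk Γ ⁻¹' {q : (Fin k → E) × E | r < ‖rowsMap q.1 q.2‖}) with hφ
  have htot : ∫⁻ Γ, φ Γ ∂(gaussianRows E k) ≤ ENNReal.ofReal (1 / 4) := by
    rw [hφ, ← Measure.prod_apply hS, Measure.prod_apply_symm hS]
    calc ∫⁻ x, gaussianRows E k ((fun Γ => (Γ, x)) ⁻¹'
            {q : (Fin k → E) × E | r < ‖rowsMap q.1 q.2‖}) ∂ν
        ≤ ∫⁻ x, ENNReal.ofReal (‖x‖ ^ 2 * (1 / (4 * m))) ∂ν := by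
          refine lintegral_mono fun x => ?_
          obtain ⟨hi, hI⟩ := integral_norm_rowsMap_sq k x
          have hmk := mul_meas_ge_le_integral_of_nonneg (μ := gaussianRows E k)
            (Filter.Eventually.of_forall fun Γ => sq_nonneg ‖rowsMap Γ x‖) hi (r ^ 2)
          rw [hI] at hmk
          dsimp only
          rw [← ofReal_measureReal]
          refine ENNReal.ofReal_le_ofReal ?_
          have hsub : (gaussianRows E k).real ((fun Γ => (Γ, x)) ⁻¹'
              {q : (Fin k → E) × E | r < ‖rowsMap q.1 q.2‖}) ≤
              (gaussianRows E k).real {Γ | r ^ 2 ≤ ‖rowsMap Γ x‖ ^ 2} := by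
            refine measureReal_mono fun Γ hΓ => ?_
            have hΓ' : r < ‖rowsMap Γ x‖ := hΓ
            simp only [Set.mem_ofPred_eq]
            gcongr
          refine hsub.trans ?_
          rw [hr2] at hmk
          rw [mul_one_div, le_div_iff₀ (by positivity)]
          rw [hr2]
          refine le_of_mul_le_mul_left ?_ hk0
          linarith
      _ = ENNReal.ofReal (∫ x, ‖x‖ ^ 2 * (1 / (4 * m)) ∂ν) :=
          (ofReal_integral_eq_lintegral_ofReal (hint.mul_const _)
            (Filter.Eventually.of_forall fun x => by positivity)).symm
      _ ≤ ENNReal.ofReal (1 / 4) := by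
          refine ENNReal.ofReal_le_ofReal ?_
          rw [integral_mul_const, mul_one_div, div_le_iff₀ (by positivity)]
          linarith
  refine ⟨{Γ | ENNReal.ofReal (1 / 2) ≤ φ Γ}ᶜ, (measurableSet_le measurable_const hmeas).compl, ?_, ?_⟩
  · rw [probReal_compl_eq_one_sub (measurableSet_le measurable_const hmeas)]
    have := (mul_meas_ge_le_lintegral (μ := gaussianRows E k) hmeas (ENNReal.ofReal (1 / 2))).trans htot
    rw [← ofReal_measureReal, ← ENNReal.ofReal_mul (by norm_num),
      ENNReal.ofReal_le_ofReal_iff (by norm_num)] at this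
    linarith
  · intro Γ hΓ
    have h1 : φ Γ < ENNReal.ofReal (1 / 2) := not_le.1 hΓ
    have hm1 : MeasurableSet {x | ‖rowsMap Γ x‖ ≤ r} :=
      (isClosed_le (rowsMap Γ).continuous.norm continuous_const).measurableSet
    have h2 := probReal_compl_eq_one_sub (μ := ν) hm1
    have h3 : ν.real {x | ‖rowsMap Γ x‖ ≤ r}ᶜ ≤ 1 / 2 := by
      refine ENNReal.toReal_le_of_le_ofReal (by norm_num) (le_trans (measure_mono ?_) h1.le)
      intro x hx
      have hx' : ¬ ‖rowsMap Γ x‖ ≤ r := hx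
      exact not_le.1 hx'
    linarith

/-- A set of mass at least `exp (-k)` contains a point around which a ball of radius of order
`√m` has mass at least `c ^ k`. -/
theorem exists_mem_le_real_closedBall (h : LogConcaveMeasure ν) {m : ℝ} (hm : 0 < m)
    (hint : Integrable (fun x => ‖x‖ ^ 2) ν) (hmom : ∫ x, ‖x‖ ^ 2 ∂ν ≤ m) {k : ℕ} (hk : 1 ≤ k)
    {A : Set E} (hA : MeasurableSet A) (hAk : Real.exp (-k) ≤ ν.real A) :
    ∃ x ∈ A, (1 / 4608) ^ k ≤ ν.real (Metric.closedBall x (50000 * √m)) := by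
  by_contra! hcon
  have hk0 : (0 : ℝ) < k := by exact_mod_cast hk
  obtain ⟨G, hG, hGhalf, hGball⟩ := half_le_gaussianRows_setOf hm hint hmom hk
  set r := 2 * √(k * m) with hr
  have hr2 : r ^ 2 = 4 * (k * m) := by
    rw [hr, mul_pow, Real.sq_sqrt (by positivity)]; norm_num
  have hr0 : 0 < r := by positivity
  have hA0 : 0 < ν.real A := (Real.exp_pos _).trans_le hAk
  set R := 50000 * √m with hR
  have hS : MeasurableSet {q : (Fin k → E) × E × E |
      q.2.1 ∈ A ∧ ‖rowsMap q.1 (q.2.1 - q.2.2)‖ ≤ 2 * r} := by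
    have hd : MeasurableSet {q : (Fin k → E) × E × E | ‖rowsMap q.1 (q.2.1 - q.2.2)‖ ≤ 2 * r} :=
      (isClosed_le (continuous_norm_rowsMap (by fun_prop) (by fun_prop))
        continuous_const).measurableSet
    exact (measurable_fst.comp measurable_snd hA).inter hd
  have hlow : ENNReal.ofReal ((1 / 32) * (1 / 36) ^ k * ν.real A) ≤
      ((gaussianRows E k).prod (ν.prod ν)) {q : (Fin k → E) × E × E |
        q.2.1 ∈ A ∧ ‖rowsMap q.1 (q.2.1 - q.2.2)‖ ≤ 2 * r} := by
    rw [Measure.prod_apply hS]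
    calc ENNReal.ofReal ((1 / 32) * (1 / 36) ^ k * ν.real A)
        ≤ ENNReal.ofReal ((1 / 16) * (1 / 36) ^ k * ν.real A * (gaussianRows E k).real G) := by
          refine ENNReal.ofReal_le_ofReal ?_
          calc (1 / 32) * (1 / 36) ^ k * ν.real A
              = (1 / 16) * (1 / 36) ^ k * ν.real A * (1 / 2) := by ring
            _ ≤ _ := by gcongr
      _ = ∫⁻ _ in G, ENNReal.ofReal ((1 / 16) * (1 / 36) ^ k * ν.real A) ∂(gaussianRows E k) := by
          rw [setLIntegral_const, ENNReal.ofReal_mul (by positivity), ofReal_measureReal]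
      _ ≤ ∫⁻ Γ in G, (ν.prod ν) (Prod.mk Γ ⁻¹' {q : (Fin k → E) × E × E |
            q.2.1 ∈ A ∧ ‖rowsMap q.1 (q.2.1 - q.2.2)‖ ≤ 2 * r}) ∂(gaussianRows E k) :=
          setLIntegral_mono' hG fun Γ hΓ => h.le_prod_norm_sub_le (rowsMap Γ) hr0 (hGball Γ hΓ) hA hAk
      _ ≤ _ := setLIntegral_le_lintegral _ _
  set β : ℝ := (1 / 128) * (1 / 36) ^ k with hβ
  have hsmall : ∀ v : E, R < ‖v‖ → (gaussianRows E k).real {Γ | ‖rowsMap Γ v‖ ≤ 2 * r} ≤ β := by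
    intro v hv
    refine (gaussianRows_real_norm_rowsMap_le k v (2 * r) (c := 1 / (16 * m)) (by positivity)).trans ?_
    have h1 : 1 / (16 * m) * (2 * r) ^ 2 = k * 1 := by
      rw [mul_pow, hr2]; field_simp; norm_num
    have hv2 : R ^ 2 ≤ ‖v‖ ^ 2 := by gcongr
    rw [hR, mul_pow, Real.sq_sqrt hm.le] at hv2
    have h2 : √(1 / (1 + 2 * (1 / (16 * m)) * ‖v‖ ^ 2)) ≤ 1 / 17000 := by
      rw [Real.sqrt_le_left (by norm_num), div_pow, one_pow]
      refine one_div_le_one_div_of_le (by norm_num) ?_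
      have : (17000 : ℝ) ^ 2 ≤ 2 * (1 / (16 * m)) * (50000 ^ 2 * m) := by
        field_simp; norm_num
      have h5 : 2 * (1 / (16 * m)) * (50000 ^ 2 * m) ≤ 2 * (1 / (16 * m)) * ‖v‖ ^ 2 := by gcongr
      linarith
    rw [h1, Real.exp_nat_mul, ← mul_pow]
    calc (Real.exp 1 * √(1 / (1 + 2 * (1 / (16 * m)) * ‖v‖ ^ 2))) ^ k
        ≤ (3 * (1 / 17000)) ^ k := by
          gcongr
          exact Real.exp_one_lt_three.le
      _ ≤ (1 / 128 * (1 / 36)) ^ k := pow_le_pow_left₀ (by norm_num) (by norm_num) k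
      _ = (1 / 128) ^ k * (1 / 36) ^ k := mul_pow _ _ _
      _ ≤ (1 / 128) ^ 1 * (1 / 36) ^ k := by
          gcongr ?_ * _
          exact pow_le_pow_of_le_one (by norm_num) (by norm_num) hk
      _ = β := by rw [pow_one]
  have hβη : ((1 : ℝ) / 4608) ^ k ≤ β := by
    calc ((1 : ℝ) / 4608) ^ k = (1 / 128) ^ k * (1 / 36) ^ k := by rw [← mul_pow]; norm_num
      _ ≤ (1 / 128) ^ 1 * (1 / 36) ^ k := by
          gcongr ?_ * _
          exact pow_le_pow_of_le_one (by norm_num) (by norm_num) hk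
      _ = β := by rw [pow_one]
  have hD : MeasurableSet {q : E × E | q.1 ∈ A ∧ ‖q.1 - q.2‖ ≤ R} := by
    have hd : MeasurableSet {q : E × E | ‖q.1 - q.2‖ ≤ R} :=
      (isClosed_le (by fun_prop) continuous_const).measurableSet
    exact (measurable_fst hA).inter hd
  have hβ0 : 0 ≤ β := by positivity
  have hup : ((gaussianRows E k).prod (ν.prod ν)) {q : (Fin k → E) × E × E |
        q.2.1 ∈ A ∧ ‖rowsMap q.1 (q.2.1 - q.2.2)‖ ≤ 2 * r} ≤
      ENNReal.ofReal ((2 * β) * ν.real A) := by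
    rw [Measure.prod_apply_symm hS]
    calc ∫⁻ q, gaussianRows E k ((fun Γ => (Γ, q)) ⁻¹' {q : (Fin k → E) × E × E |
            q.2.1 ∈ A ∧ ‖rowsMap q.1 (q.2.1 - q.2.2)‖ ≤ 2 * r}) ∂(ν.prod ν)
        ≤ ∫⁻ q, ({q : E × E | q.1 ∈ A ∧ ‖q.1 - q.2‖ ≤ R}.indicator (fun _ => 1) q +
            (A ×ˢ Set.univ).indicator (fun _ => ENNReal.ofReal β) q) ∂(ν.prod ν) := by
          refine lintegral_mono fun q => ?_
          by_cases hqA : q.1 ∈ A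
          · by_cases hq : ‖q.1 - q.2‖ ≤ R
            · refine le_add_right ?_
              rw [Set.indicator_of_mem (show q ∈ {q : E × E | q.1 ∈ A ∧ ‖q.1 - q.2‖ ≤ R} from
                ⟨hqA, hq⟩)]
              exact prob_le_one
            · refine le_add_left ?_
              rw [Set.indicator_of_mem (show q ∈ A ×ˢ (Set.univ : Set E) from ⟨hqA, trivial⟩),
                ← ofReal_measureReal]
              refine ENNReal.ofReal_le_ofReal
                (le_trans (measureReal_mono ?_) (hsmall _ (not_le.1 hq)))
              exact fun Γ hΓ => hΓ.2
          · have hempty : (fun Γ => (Γ, q)) ⁻¹' {q : (Fin k → E) × E × E |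
                q.2.1 ∈ A ∧ ‖rowsMap q.1 (q.2.1 - q.2.2)‖ ≤ 2 * r} = ∅ := by
              ext Γ
              simp [hqA]
            rw [hempty, measure_empty]
            exact bot_le
      _ = (ν.prod ν) {q : E × E | q.1 ∈ A ∧ ‖q.1 - q.2‖ ≤ R} + ENNReal.ofReal β * ν A := by
          rw [lintegral_add_left (measurable_const.indicator hD), lintegral_indicator hD,
            lintegral_indicator (hA.prod MeasurableSet.univ), setLIntegral_const,
            setLIntegral_const, Measure.prod_prod]
          simp
      _ ≤ ENNReal.ofReal β * ν A + ENNReal.ofReal β * ν A := by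
          gcongr
          rw [Measure.prod_apply hD, ← setLIntegral_const, ← lintegral_indicator hA]
          refine lintegral_mono fun x => ?_
          by_cases hx : x ∈ A
          · rw [Set.indicator_of_mem hx, ← ofReal_measureReal]
            refine ENNReal.ofReal_le_ofReal (le_trans (measureReal_mono ?_) ((hcon x hx).le.trans hβη))
            intro y hy
            rw [Metric.mem_closedBall, dist_comm, dist_eq_norm]
            exact hy.2
          · have hempty : Prod.mk x ⁻¹' {q : E × E | q.1 ∈ A ∧ ‖q.1 - q.2‖ ≤ R} = ∅ := by
              ext y
              simp [hx]
            rw [hempty, measure_empty]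
            exact bot_le
      _ = ENNReal.ofReal ((2 * β) * ν.real A) := by
          rw [← two_mul, ENNReal.ofReal_mul (p := 2 * β) (by positivity),
            ENNReal.ofReal_mul (p := 2) (by positivity), ofReal_measureReal, ENNReal.ofReal_ofNat,
            mul_assoc]
  have hfin := hlow.trans hup
  rw [ENNReal.ofReal_le_ofReal_iff (by positivity)] at hfin
  have h36 : (0 : ℝ) < (1 / 36) ^ k := by positivity
  have hpos : 0 < (1 / 36 : ℝ) ^ k * ν.real A := by positivity
  rw [hβ] at hfin
  linarith

end SmallBall

end LogConcaveMeasure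

/-- The constant in the truncated moment bound for log-concave measures. -/
def truncatedMomentConst (q : ℕ) : ℝ := ∑' j : ℕ, ((j : ℝ) + 2) ^ q * Real.exp (-j)

theorem summable_add_two_pow_mul_exp_neg (q : ℕ) :
    Summable fun j : ℕ => ((j : ℝ) + 2) ^ q * Real.exp (-j) := by
  have h := (summable_nat_add_iff 2).2 (Real.summable_pow_mul_exp_neg_nat_mul q (r := 1) one_pos)
  refine (h.mul_left (Real.exp 2)).congr fun j => ?_
  have : Real.exp (-j) = Real.exp 2 * Real.exp (-1 * ((j + 2 : ℕ) : ℝ)) := by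
    rw [← Real.exp_add]; congr 1; push_cast; ring
  rw [this]; push_cast; ring

theorem truncatedMomentConst_nonneg (q : ℕ) : 0 ≤ truncatedMomentConst q :=
  tsum_nonneg fun _ => by positivity

namespace LogConcaveMeasure

section Moments

variable {E F : Type*} [NormedAddCommGroup E] [NormedSpace ℝ E] [MeasurableSpace E] [BorelSpace E]
  [NormedAddCommGroup F] [NormedSpace ℝ F] {ν : Measure E}

theorem lintegral_norm_pow_le [IsFiniteMeasure ν] (h : LogConcaveMeasure ν) (T : E →L[ℝ] F)
    {s ρ t : ℝ} (hs : 0 < s) (hρ0 : 0 < ρ) (hρ2 : ρ ≤ Real.exp (-2))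
    (hρ : ν.real {x | s ≤ ‖T x‖} ≤ ρ * ν.real {x | ‖T x‖ ≤ s}) (ht : 1 ≤ t) (q : ℕ) :
    ∫⁻ x in {x | t * s ≤ ‖T x‖}, ENNReal.ofReal (‖T x‖ ^ q) ∂ν ≤
      ENNReal.ofReal (truncatedMomentConst q * ((t * s) ^ q * ρ ^ (t / 2) * ν.real Set.univ)) := by
  have hts : 0 < t * s := by positivity
  have hρ1 : ρ ≤ 1 := hρ2.trans (Real.exp_le_one_iff.2 (by norm_num))
  have hmeas (u : ℝ) : MeasurableSet {x | u ≤ ‖T x‖} :=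
    (isClosed_le continuous_const T.continuous.norm).measurableSet
  calc ∫⁻ x in {x | t * s ≤ ‖T x‖}, ENNReal.ofReal (‖T x‖ ^ q) ∂ν
      ≤ ∫⁻ x, ∑' j : ℕ, {x | ((j : ℝ) + 1) * (t * s) ≤ ‖T x‖}.indicator
          (fun _ => ENNReal.ofReal ((((j : ℝ) + 2) * (t * s)) ^ q)) x ∂ν := by
        rw [← lintegral_indicator (hmeas _)]
        refine lintegral_mono fun x => ?_
        by_cases hx : x ∈ {x | t * s ≤ ‖T x‖}
        · rw [Set.indicator_of_mem hx]
          have hx' : 1 ≤ ‖T x‖ / (t * s) := (one_le_div hts).2 hx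
          obtain ⟨j, hj⟩ : ∃ j, ⌊‖T x‖ / (t * s)⌋₊ = j + 1 :=
            Nat.exists_eq_add_of_le' ((Nat.one_le_floor_iff _).2 hx')
          have h1 := Nat.floor_le (zero_le_one.trans hx')
          have h2 := Nat.lt_floor_add_one (‖T x‖ / (t * s))
          rw [hj, le_div_iff₀ hts] at h1
          rw [hj, div_lt_iff₀ hts] at h2
          push_cast at h1 h2
          refine le_trans ?_ (ENNReal.le_tsum j)
          rw [Set.indicator_of_mem (by exact h1)]
          refine ENNReal.ofReal_le_ofReal (pow_le_pow_left₀ (norm_nonneg _) ?_ q)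
          linarith
        · rw [Set.indicator_of_notMem hx]
          exact bot_le
    _ = ∑' j : ℕ, ENNReal.ofReal ((((j : ℝ) + 2) * (t * s)) ^ q) *
          ν {x | ((j : ℝ) + 1) * (t * s) ≤ ‖T x‖} := by
        rw [lintegral_tsum fun j => (measurable_const.indicator (hmeas _)).aemeasurable]
        exact tsum_congr fun j => by rw [lintegral_indicator (hmeas _), setLIntegral_const]
    _ ≤ ∑' j : ℕ, ENNReal.ofReal ((((j : ℝ) + 2) ^ q * Real.exp (-j)) *
          ((t * s) ^ q * ρ ^ (t / 2) * ν.real Set.univ)) := by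
        refine ENNReal.tsum_le_tsum fun j => ?_
        rw [← ofReal_measureReal, ← ENNReal.ofReal_mul (by positivity)]
        refine ENNReal.ofReal_le_ofReal ?_
        have hj : (0 : ℝ) ≤ j := j.cast_nonneg
        have hb := h.real_norm_ge_mul_le T hs hρ0 hρ1 hρ (t := ((j : ℝ) + 1) * t) (by nlinarith)
        rw [mul_assoc] at hb
        have hpow : ρ ^ (((j : ℝ) + 1) * t / 2) ≤ Real.exp (-j) * ρ ^ (t / 2) := by
          have he : ρ ^ ((j : ℝ) * t / 2) ≤ Real.exp (-j) := by
            calc ρ ^ ((j : ℝ) * t / 2) ≤ Real.exp (-2) ^ ((j : ℝ) * t / 2) := by gcongr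
              _ = Real.exp (-(j * t)) := by rw [← Real.exp_mul]; congr 1; ring
              _ ≤ Real.exp (-j) := Real.exp_le_exp.2 (by nlinarith)
          calc ρ ^ (((j : ℝ) + 1) * t / 2) = ρ ^ ((j : ℝ) * t / 2) * ρ ^ (t / 2) := by
                rw [← Real.rpow_add hρ0]; congr 1; ring
            _ ≤ _ := by gcongr
        calc (((j : ℝ) + 2) * (t * s)) ^ q * ν.real {x | ((j : ℝ) + 1) * (t * s) ≤ ‖T x‖}
            ≤ (((j : ℝ) + 2) * (t * s)) ^ q *
                (Real.exp (-j) * ρ ^ (t / 2) * ν.real Set.univ) := by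
              gcongr
              exact hb.trans (by gcongr)
          _ = _ := by rw [mul_pow]; ring
    _ = _ := by
        rw [truncatedMomentConst, ← tsum_mul_right, ENNReal.ofReal_tsum_of_nonneg
          (fun j => by positivity) ((summable_add_two_pow_mul_exp_neg q).mul_right _)]

theorem integrableOn_norm_pow [IsFiniteMeasure ν] (h : LogConcaveMeasure ν) (T : E →L[ℝ] F)
    {s ρ t : ℝ} (hs : 0 < s) (hρ0 : 0 < ρ) (hρ2 : ρ ≤ Real.exp (-2))
    (hρ : ν.real {x | s ≤ ‖T x‖} ≤ ρ * ν.real {x | ‖T x‖ ≤ s}) (ht : 1 ≤ t) (q : ℕ) :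
    IntegrableOn (fun x => ‖T x‖ ^ q) {x | t * s ≤ ‖T x‖} ν := by
  refine ⟨(T.continuous.norm.pow q).measurable.aestronglyMeasurable, ?_⟩
  rw [hasFiniteIntegral_iff_ofReal (Filter.Eventually.of_forall fun x => by positivity)]
  exact (h.lintegral_norm_pow_le T hs hρ0 hρ2 hρ ht q).trans_lt ENNReal.ofReal_lt_top

theorem setIntegral_norm_pow_le [IsFiniteMeasure ν] (h : LogConcaveMeasure ν) (T : E →L[ℝ] F)
    {s ρ t : ℝ} (hs : 0 < s) (hρ0 : 0 < ρ) (hρ2 : ρ ≤ Real.exp (-2))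
    (hρ : ν.real {x | s ≤ ‖T x‖} ≤ ρ * ν.real {x | ‖T x‖ ≤ s}) (ht : 1 ≤ t) (q : ℕ) :
    ∫ x in {x | t * s ≤ ‖T x‖}, ‖T x‖ ^ q ∂ν ≤
      truncatedMomentConst q * ((t * s) ^ q * ρ ^ (t / 2) * ν.real Set.univ) := by
  have hC := truncatedMomentConst_nonneg q
  have hts : 0 < t * s := by positivity
  rw [← ENNReal.ofReal_le_ofReal_iff (by positivity), ofReal_integral_eq_lintegral_ofReal
    (h.integrableOn_norm_pow T hs hρ0 hρ2 hρ ht q)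
    (Filter.Eventually.of_forall fun x => by positivity)]
  exact h.lintegral_norm_pow_le T hs hρ0 hρ2 hρ ht q

theorem integrable_norm_pow [IsFiniteMeasure ν] (h : LogConcaveMeasure ν) (q : ℕ) :
    Integrable (fun x => ‖x‖ ^ q) ν := by
  rcases eq_or_ne ν 0 with rfl | hν
  · exact integrable_zero_measure
  have hpos : 0 < ν.real Set.univ := by
    rw [measureReal_def]
    exact ENNReal.toReal_pos (by simpa using hν) (measure_ne_top _ _)
  have hmeas (u : ℝ) : MeasurableSet {x : E | u ≤ ‖x‖} :=
    (isClosed_le continuous_const continuous_norm).measurableSet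
  have htend : Filter.Tendsto (fun s : ℕ => ν.real {x : E | (s : ℝ) ≤ ‖x‖}) Filter.atTop (nhds 0) := by
    have hanti : Antitone fun s : ℕ => {x : E | (s : ℝ) ≤ ‖x‖} := fun a b hab x
        (hx : (b : ℝ) ≤ ‖x‖) => show (a : ℝ) ≤ ‖x‖ from le_trans (Nat.cast_le.2 hab) hx
    have := tendsto_measure_iInter_atTop (μ := ν) (fun s => (hmeas ((s : ℕ) : ℝ)).nullMeasurableSet)
      hanti ⟨0, measure_ne_top _ _⟩
    have hemp : ⋂ s : ℕ, {x : E | (s : ℝ) ≤ ‖x‖} = ∅ := by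
      refine Set.eq_empty_of_forall_notMem fun x hx => ?_
      obtain ⟨s, hs⟩ := exists_nat_gt ‖x‖
      exact hs.not_ge (Set.mem_iInter.1 hx s)
    rw [hemp, measure_empty] at this
    exact (ENNReal.tendsto_toReal ENNReal.zero_ne_top).comp this
  have he0 := Real.exp_pos (-2)
  have he1 : Real.exp (-2) ≤ 1 := Real.exp_le_one_iff.2 (by norm_num)
  obtain ⟨s, hs, hs1⟩ := ((htend.eventually_lt_const
    (show 0 < Real.exp (-2) * (ν.real Set.univ / 2) by positivity)).and
    (Filter.eventually_ge_atTop 1)).exists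
  have hs0 : (0 : ℝ) < s := by exact_mod_cast hs1
  have hρ : ν.real {x | (s : ℝ) ≤ ‖ContinuousLinearMap.id ℝ E x‖} ≤
      Real.exp (-2) * ν.real {x | ‖ContinuousLinearMap.id ℝ E x‖ ≤ s} := by
    simp only [ContinuousLinearMap.id_apply]
    have hsub : ν.real Set.univ ≤ ν.real {x : E | (s : ℝ) ≤ ‖x‖} + ν.real {x : E | ‖x‖ ≤ s} :=
      (measureReal_mono (fun x _ => le_total (s : ℝ) ‖x‖)).trans (measureReal_union_le _ _)
    have : ν.real Set.univ / 2 ≤ ν.real {x : E | ‖x‖ ≤ s} := by nlinarith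
    exact hs.le.trans (by gcongr)
  have h1 := h.integrableOn_norm_pow _ hs0 he0 le_rfl hρ le_rfl q
  simp only [ContinuousLinearMap.id_apply, one_mul] at h1
  have h2 : IntegrableOn (fun x => ‖x‖ ^ q) {x : E | (s : ℝ) ≤ ‖x‖}ᶜ ν := by
    refine Measure.integrableOn_of_bounded (M := (s : ℝ) ^ q) (measure_ne_top _ _)
      (continuous_norm.pow q).measurable.aestronglyMeasurable ?_
    refine (ae_restrict_iff' (hmeas _).compl).2 (Filter.Eventually.of_forall fun x hx => ?_)
    have hx' : ¬ (s : ℝ) ≤ ‖x‖ := hx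
    rw [norm_pow, norm_norm]
    gcongr
    exact (not_le.1 hx').le
  rw [← integrableOn_univ, ← Set.union_compl_self {x : E | (s : ℝ) ≤ ‖x‖}]
  exact h1.union h2

end Moments

end LogConcaveMeasure

theorem abs_inner_rpow_le {E : Type*} [NormedAddCommGroup E] [InnerProductSpace ℝ E]
    (v x : E) {p : ℝ} (hp : 0 ≤ p) :
    |⟪v, x⟫| ^ p ≤ ‖v‖ ^ p * ‖x‖ ^ p := by
  rw [← Real.mul_rpow (norm_nonneg _) (norm_nonneg _)]
  exact Real.rpow_le_rpow (abs_nonneg _) (abs_real_inner_le_norm v x) hp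

namespace LogConcaveMeasure

section Paouris

variable {E : Type*} [NormedAddCommGroup E] [InnerProductSpace ℝ E] [MeasurableSpace E]
  [BorelSpace E] {ν : Measure E}

theorem integrable_norm_rpow [IsFiniteMeasure ν] (h : LogConcaveMeasure ν) {p : ℝ} (hp : 0 ≤ p) :
    Integrable (fun x => ‖x‖ ^ p) ν := by
  refine ((integrable_const (1 : ℝ)).add (h.integrable_norm_pow ⌈p⌉₊)).mono'
    (continuous_norm.rpow_const fun _ => Or.inr hp).measurable.aestronglyMeasurable
    (Filter.Eventually.of_forall fun x => ?_)
  rw [Real.norm_of_nonneg (by positivity), Pi.add_apply]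
  rcases le_total ‖x‖ 1 with hx | hx
  · have := Real.rpow_le_one (norm_nonneg x) hx hp
    have : 0 ≤ ‖x‖ ^ ⌈p⌉₊ := by positivity
    linarith
  · have := Real.rpow_le_rpow_of_exponent_le hx (Nat.le_ceil p)
    rw [Real.rpow_natCast] at this
    linarith

theorem integrable_abs_inner_rpow [IsFiniteMeasure ν] (h : LogConcaveMeasure ν) (v : E) {p : ℝ}
    (hp : 0 ≤ p) : Integrable (fun x => |⟪v, x⟫| ^ p) ν := by
  refine ((h.integrable_norm_rpow hp).const_mul (‖v‖ ^ p)).mono'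
    ((continuous_const.inner continuous_id).abs.rpow_const
      fun _ => Or.inr hp).measurable.aestronglyMeasurable (Filter.Eventually.of_forall fun x => ?_)
  rw [Real.norm_of_nonneg (by positivity)]
  exact abs_inner_rpow_le v x hp

variable [FiniteDimensional ℝ E] [IsProbabilityMeasure ν]

/-- A large deviation inequality of Paouris type. -/
theorem real_norm_ge_le_exp (h : LogConcaveMeasure ν) {m σ p : ℝ} (hm : 0 < m) (hσ : 0 ≤ σ)
    (hp : 1 ≤ p) (hmom : ∫ x, ‖x‖ ^ 2 ∂ν ≤ m)
    (hσp : ∀ v : E, ‖v‖ ≤ 1 → ∫ x, |⟪v, x⟫| ^ p ∂ν ≤ σ ^ p) :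
    ν.real {x | 50001 * √m + 4608 ^ 4 * σ ≤ ‖x‖} ≤ Real.exp (-(3 * p)) := by
  by_contra! hcon
  have hp0 : 0 < p := by linarith
  have hsm : 0 < √m := Real.sqrt_pos.2 hm
  have hk1 : 1 ≤ ⌈3 * p⌉₊ := Nat.one_le_iff_ne_zero.2 (Nat.ceil_pos.2 (by positivity)).ne'
  have hkle : (⌈3 * p⌉₊ : ℝ) ≤ 4 * p := by
    have := (Nat.ceil_lt_add_one (show 0 ≤ 3 * p by positivity)).le
    linarith
  obtain ⟨y, hy, hball⟩ := h.exists_mem_le_real_closedBall hm (h.integrable_norm_pow 2) hmom hk1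
    (isClosed_le continuous_const continuous_norm).measurableSet
    ((Real.exp_le_exp.2 (neg_le_neg (Nat.le_ceil (3 * p)))).trans hcon.le)
  have hy' : 50001 * √m + 4608 ^ 4 * σ ≤ ‖y‖ := hy
  have hy0 : 0 < ‖y‖ := by
    have : 0 ≤ 4608 ^ 4 * σ := by positivity
    linarith
  set u := ‖y‖⁻¹ • y
  have hu : ‖u‖ = 1 := by rw [norm_smul, norm_inv, norm_norm, inv_mul_cancel₀ hy0.ne']
  set w := √m + 4608 ^ 4 * σ
  have hw : 0 < w := by positivity
  have hsub : Metric.closedBall y (50000 * √m) ⊆ {x | w ^ p ≤ |⟪u, x⟫| ^ p} := by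
    intro x hx
    rw [mem_closedBall_iff_norm] at hx
    have h1 : ⟪u, x⟫ = ‖y‖ + ⟪u, x - y⟫ := by
      rw [inner_sub_right]
      have : ⟪u, y⟫ = ‖y‖ := by
        rw [real_inner_smul_left, real_inner_self_eq_norm_sq]; field_simp
      rw [this]; ring
    have h2 : -(50000 * √m) ≤ ⟪u, x - y⟫ := by
      have := abs_real_inner_le_norm u (x - y)
      rw [hu, one_mul] at this
      linarith [(abs_le.1 (this.trans hx)).1]
    refine Real.rpow_le_rpow hw.le (le_trans ?_ (le_abs_self _)) hp0.le
    rw [h1]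
    simp only [w]
    linarith
  have hmk := mul_meas_ge_le_integral_of_nonneg
    (Filter.Eventually.of_forall fun x => Real.rpow_nonneg (abs_nonneg ⟪u, x⟫) p)
    (h.integrable_abs_inner_rpow u hp0.le) (w ^ p)
  have hfin : w ^ p * (1 / 4608) ^ (4 * p) ≤ σ ^ p := by
    refine le_trans ?_ (hmk.trans (hσp u hu.le))
    gcongr
    calc ((1 : ℝ) / 4608) ^ (4 * p) ≤ (1 / 4608) ^ (⌈3 * p⌉₊ : ℝ) :=
          Real.rpow_le_rpow_of_exponent_ge (by norm_num) (by norm_num) hkle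
      _ = (1 / 4608) ^ ⌈3 * p⌉₊ := Real.rpow_natCast _ _
      _ ≤ _ := hball.trans (measureReal_mono hsub)
  rw [Real.rpow_mul (by norm_num), ← Real.mul_rpow hw.le (by positivity)] at hfin
  have hlt := (Real.rpow_le_rpow_iff (by positivity) hσ hp0).1 hfin
  have h4 : ((1 : ℝ) / 4608) ^ (4 : ℝ) = 1 / 4608 ^ 4 := by
    rw [show (4 : ℝ) = ((4 : ℕ) : ℝ) by norm_num, Real.rpow_natCast, div_pow, one_pow]
  rw [h4, mul_one_div, div_le_iff₀ (by positivity)] at hlt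
  simp only [w] at hlt
  linarith

end Paouris

section Conditional

variable {E F : Type*} [NormedAddCommGroup E] [NormedSpace ℝ E] [MeasurableSpace E]
  [BorelSpace E] [NormedAddCommGroup F] [InnerProductSpace ℝ F] [FiniteDimensional ℝ F]
  {ν : Measure E} [IsProbabilityMeasure ν]

/-- The second moment of a linear image, restricted to a set of mass at least `exp (-p)`. -/
theorem setIntegral_norm_sq_le (h : LogConcaveMeasure ν) (T : E →L[ℝ] F) {m σ p : ℝ}
    (hm : 0 < m) (hσ : 0 ≤ σ) (hp : 1 ≤ p) (hmom : ∫ x, ‖T x‖ ^ 2 ∂ν ≤ m)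
    (hσp : ∀ v : F, ‖v‖ ≤ 1 → ∫ x, |⟪v, T x⟫| ^ p ∂ν ≤ σ ^ p) {A : Set E} (hA : MeasurableSet A)
    (hAp : Real.exp (-p) ≤ ν.real A) :
    ∫ x in A, ‖T x‖ ^ 2 ∂ν ≤
      (1 + truncatedMomentConst 2) * (2 * 4608 ^ 8) * (σ ^ 2 + m) * ν.real A := by
  borelize F
  have hT := T.continuous.measurable
  have hp0 : 0 < p := by linarith
  have hsm : 0 < √m := Real.sqrt_pos.2 hm
  set s := 50001 * √m + 4608 ^ 4 * σ with hs
  have hs0 : 0 < s := by positivity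
  have hC := truncatedMomentConst_nonneg 2
  have hmT : MeasurableSet {x | s ≤ ‖T x‖} :=
    (isClosed_le continuous_const T.continuous.norm).measurableSet
  have htail : ν.real {x | s ≤ ‖T x‖} ≤ Real.exp (-(3 * p)) := by
    have : IsProbabilityMeasure (ν.map T) := Measure.isProbabilityMeasure_map hT.aemeasurable
    have := (h.map T).real_norm_ge_le_exp hm hσ hp (by
      rwa [integral_map hT.aemeasurable (by fun_prop)]) (fun v hv => by
      rw [integral_map hT.aemeasurable ((continuous_const.inner continuous_id').abs.rpow_const
        fun _ => Or.inr hp0.le).measurable.aestronglyMeasurable]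
      exact hσp v hv)
    rwa [map_measureReal_apply hT (isClosed_le continuous_const continuous_norm).measurableSet]
      at this
  have hexp : Real.exp (-p) ≤ 1 / 2 := by
    have h2 : (2 : ℝ) ≤ Real.exp p := by linarith [Real.add_one_le_exp p]
    rw [Real.exp_neg, ← one_div]
    exact one_div_le_one_div_of_le (by norm_num) h2
  have hep := Real.exp_pos (-p)
  have hexp3 : Real.exp (-(3 * p)) = Real.exp (-(2 * p)) * Real.exp (-p) := by
    rw [← Real.exp_add]; congr 1; ring
  have he2 : Real.exp (-(2 * p)) ≤ Real.exp (-2) := Real.exp_le_exp.2 (by linarith)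
  have he21 : Real.exp (-(2 * p)) ≤ 1 := Real.exp_le_one_iff.2 (by linarith)
  have hρ : ν.real {x | s ≤ ‖T x‖} ≤ Real.exp (-(2 * p)) * ν.real {x | ‖T x‖ ≤ s} := by
    have hsub : ν.real {x | s ≤ ‖T x‖}ᶜ ≤ ν.real {x | ‖T x‖ ≤ s} :=
      measureReal_mono fun x hx => le_of_lt (not_le.1 (show ¬ s ≤ ‖T x‖ from hx))
    rw [probReal_compl_eq_one_sub hmT] at hsub
    have : Real.exp (-p) ≤ ν.real {x | ‖T x‖ ≤ s} := by nlinarith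
    exact htail.trans (hexp3.trans_le (by gcongr))
  have hint : Integrable (fun x => ‖T x‖ ^ 2) ν := by
    refine ((h.integrable_norm_pow 2).const_mul (‖T‖ ^ 2)).mono'
      (T.continuous.norm.pow 2).measurable.aestronglyMeasurable
      (Filter.Eventually.of_forall fun x => ?_)
    rw [norm_pow, norm_norm, ← mul_pow]
    gcongr
    exact T.le_opNorm x
  have hbig : ∫ x in {x | s ≤ ‖T x‖}, ‖T x‖ ^ 2 ∂ν ≤
      truncatedMomentConst 2 * s ^ 2 * ν.real A := by
    have := h.setIntegral_norm_pow_le T hs0 (Real.exp_pos _) he2 hρ le_rfl 2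
    rw [one_mul, probReal_univ, mul_one, ← Real.exp_mul,
      show -(2 * p) * (1 / 2) = -p by ring, ← mul_assoc] at this
    exact this.trans (by gcongr)
  have hs2 : s ^ 2 ≤ (2 * 4608 ^ 8) * (σ ^ 2 + m) := by
    have hsq := Real.sq_sqrt hm.le
    have : s ^ 2 ≤ 2 * ((50001 * √m) ^ 2 + (4608 ^ 4 * σ) ^ 2) := by
      rw [hs]; linarith [sq_nonneg (50001 * √m - 4608 ^ 4 * σ)]
    rw [mul_pow, mul_pow, hsq] at this
    nlinarith [sq_nonneg σ]
  calc ∫ x in A, ‖T x‖ ^ 2 ∂ν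
      ≤ ∫ x, (A.indicator (fun _ => s ^ 2) x +
          {x | s ≤ ‖T x‖}.indicator (fun x => ‖T x‖ ^ 2) x) ∂ν := by
        rw [← integral_indicator hA]
        refine integral_mono (hint.indicator hA)
          (((integrable_const _).indicator hA).add (hint.indicator hmT)) fun x => ?_
        by_cases hxA : x ∈ A
        · simp only [Set.indicator_of_mem hxA]
          by_cases hx : x ∈ {x | s ≤ ‖T x‖}
          · rw [Set.indicator_of_mem hx]
            linarith [sq_nonneg s]
          · rw [Set.indicator_of_notMem hx, add_zero]
            have hx' : ‖T x‖ ≤ s := (not_le.1 (show ¬ s ≤ ‖T x‖ from hx)).le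
            gcongr
        · simp only [Set.indicator_of_notMem hxA, zero_add]
          exact Set.indicator_nonneg (fun _ _ => by positivity) x
    _ = s ^ 2 * ν.real A + ∫ x in {x | s ≤ ‖T x‖}, ‖T x‖ ^ 2 ∂ν := by
        rw [integral_add ((integrable_const _).indicator hA) (hint.indicator hmT),
          integral_indicator hA, integral_indicator hmT, setIntegral_const, smul_eq_mul, mul_comm]
    _ ≤ (1 + truncatedMomentConst 2) * s ^ 2 * ν.real A := by linarith
    _ ≤ (1 + truncatedMomentConst 2) * ((2 * 4608 ^ 8) * (σ ^ 2 + m)) * ν.real A := by gcongr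
    _ = _ := by ring

end Conditional

end LogConcaveMeasure

/-- The coordinate projection of `ℝⁿ` onto the coordinates in `I`. -/
def coordProj {n : ℕ} (I : Finset (Fin n)) :
    EuclideanSpace ℝ (Fin n) →L[ℝ] EuclideanSpace ℝ (Fin n) :=
  LinearMap.toContinuousLinearMap
    { toFun := fun x => WithLp.toLp 2 fun i => if i ∈ I then x i else 0
      map_add' := fun x y => by ext i; by_cases hi : i ∈ I <;> simp [hi]
      map_smul' := fun c x => by ext i; by_cases hi : i ∈ I <;> simp [hi] }

section CoordProj

variable {n : ℕ} (I : Finset (Fin n))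

theorem coordProj_apply (x : EuclideanSpace ℝ (Fin n)) (i : Fin n) :
    coordProj I x i = if i ∈ I then x i else 0 := rfl

theorem norm_coordProj_sq (x : EuclideanSpace ℝ (Fin n)) :
    ‖coordProj I x‖ ^ 2 = ∑ i ∈ I, x i ^ 2 := by
  rw [EuclideanSpace.norm_sq_eq]
  simp [coordProj_apply, Finset.sum_ite_mem, apply_ite, ite_pow]

theorem norm_coordProj_le (x : EuclideanSpace ℝ (Fin n)) : ‖coordProj I x‖ ≤ ‖x‖ := by
  refine (sq_le_sq₀ (norm_nonneg _) (norm_nonneg _)).1 ?_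
  rw [norm_coordProj_sq, EuclideanSpace.norm_sq_eq]
  simp only [Real.norm_eq_abs, sq_abs]
  exact Finset.sum_le_univ_sum_of_nonneg fun i => sq_nonneg _

theorem inner_coordProj (v x : EuclideanSpace ℝ (Fin n)) :
    ⟪v, coordProj I x⟫ = ⟪coordProj I v, x⟫ := by
  simp only [PiLp.inner_apply, coordProj_apply]
  exact Finset.sum_congr rfl fun i _ => by split_ifs <;> simp

end CoordProj

namespace LogConcaveMeasure

section Coordinates

variable {n : ℕ} {ν : Measure (EuclideanSpace ℝ (Fin n))} [IsProbabilityMeasure ν]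

theorem integrable_coord_sq (h : LogConcaveMeasure ν) (i : Fin n) :
    Integrable (fun x => x i ^ 2) ν := by
  refine (h.integrable_norm_pow 2).mono' (by fun_prop) (Filter.Eventually.of_forall fun x => ?_)
  rw [norm_pow]
  gcongr
  exact PiLp.norm_apply_le x i

theorem sum_setIntegral_coord_sq_le (h : LogConcaveMeasure ν) {σ p : ℝ} (hσ : 0 ≤ σ) (hp : 1 ≤ p)
    (hmom : ∀ i, ∫ x, x i ^ 2 ∂ν ≤ 1)
    (hσp : ∀ v : EuclideanSpace ℝ (Fin n), ‖v‖ ≤ 1 → ∫ x, |⟪v, x⟫| ^ p ∂ν ≤ σ ^ p)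
    {A : Set (EuclideanSpace ℝ (Fin n))} (hA : MeasurableSet A)
    (hAp : Real.exp (-p) ≤ ν.real A) (I : Finset (Fin n)) :
    ∑ i ∈ I, ∫ x in A, x i ^ 2 ∂ν ≤
      (1 + truncatedMomentConst 2) * (2 * 4608 ^ 8) * (σ ^ 2 + I.card) * ν.real A := by
  have hC := truncatedMomentConst_nonneg 2
  rcases I.eq_empty_or_nonempty with rfl | hI
  · rw [Finset.sum_empty]
    positivity
  rw [← integral_finsetSum _ fun i _ => (h.integrable_coord_sq i).integrableOn]
  simp_rw [← norm_coordProj_sq]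
  refine h.setIntegral_norm_sq_le (coordProj I) (by exact_mod_cast hI.card_pos) hσ hp ?_ ?_ hA hAp
  · simp_rw [norm_coordProj_sq]
    rw [integral_finsetSum _ fun i _ => h.integrable_coord_sq i]
    exact (Finset.sum_le_sum fun i _ => hmom i).trans (by simp)
  · intro v hv
    simp_rw [inner_coordProj]
    exact hσp _ ((norm_coordProj_le I v).trans hv)

/-- On a closed convex set where the second moment of a coordinate is bounded, the truncated second
moment decays exponentially. -/
theorem setIntegral_coord_sq_le (h : LogConcaveMeasure ν) {K : Set (EuclideanSpace ℝ (Fin n))}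
    (hK : IsClosed K) (hconv : Convex ℝ K) {B : ℝ} (hB : 0 < B) (i : Fin n)
    (hi : ∫ x in K, x i ^ 2 ∂ν ≤ B ^ 2 * ν.real K) {t : ℝ} (ht : 1 ≤ t) :
    ∫ x in K ∩ {x | t ≤ x i}, x i ^ 2 ∂ν ≤
      (truncatedMomentConst 2 + 3 * B ^ 2) * (t ^ 2 * Real.exp (-t / (4 * B))) * ν.real K := by
  have hC := truncatedMomentConst_nonneg 2
  have hKm := hK.measurableSet
  have hNK : 0 ≤ ν.real K := measureReal_nonneg
  have hint := h.integrable_coord_sq i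
  have hs0 : 0 < 4 * B := by positivity
  rcases lt_or_ge t (4 * B) with hts | hts
  · calc ∫ x in K ∩ {x | t ≤ x i}, x i ^ 2 ∂ν ≤ ∫ x in K, x i ^ 2 ∂ν :=
          setIntegral_mono_set hint.integrableOn
            (Filter.Eventually.of_forall fun x => sq_nonneg _)
            (Filter.Eventually.of_forall fun x hx => hx.1)
      _ ≤ B ^ 2 * 1 * ν.real K := by rwa [mul_one]
      _ ≤ B ^ 2 * (3 * (t ^ 2 * Real.exp (-t / (4 * B)))) * ν.real K := by
          gcongr
          have h1 : Real.exp (-1) ≤ Real.exp (-t / (4 * B)) := by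
            rw [Real.exp_le_exp, le_div_iff₀ hs0]; linarith
          have h2 : 1 ≤ 3 * Real.exp (-1) := by
            have := Real.exp_one_lt_three
            have h3 : Real.exp 1 * Real.exp (-1) = 1 := by rw [← Real.exp_add]; simp
            nlinarith [Real.exp_pos (-1)]
          have h3 : 1 ≤ t ^ 2 := one_le_pow₀ ht
          nlinarith [Real.exp_pos (-1)]
      _ ≤ _ := by
          have : 0 ≤ truncatedMomentConst 2 * (t ^ 2 * Real.exp (-t / (4 * B))) * ν.real K := by
            positivity
          linarith
  · set T : EuclideanSpace ℝ (Fin n) →L[ℝ] ℝ := EuclideanSpace.proj i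
    have hTx (x : EuclideanSpace ℝ (Fin n)) : ‖T x‖ = |x i| := rfl
    have hm (u : ℝ) : MeasurableSet {x : EuclideanSpace ℝ (Fin n) | u ≤ ‖T x‖} :=
      (isClosed_le continuous_const T.continuous.norm).measurableSet
    have h16 : (ν.restrict K).real {x | 4 * B ≤ ‖T x‖} ≤ ν.real K / 16 := by
      have hmk := mul_meas_ge_le_integral_of_nonneg (μ := ν.restrict K)
        (Filter.Eventually.of_forall fun x : EuclideanSpace ℝ (Fin n) => sq_nonneg (x i))
        hint.integrableOn ((4 * B) ^ 2)
      have hsub : (ν.restrict K).real {x | 4 * B ≤ ‖T x‖} ≤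
          (ν.restrict K).real {x | (4 * B) ^ 2 ≤ x i ^ 2} := by
        refine measureReal_mono fun x hx => ?_
        have hx' : 4 * B ≤ |x i| := hx
        simp only [Set.mem_ofPred_eq]
        rw [← sq_abs (x i)]
        gcongr
      have : (4 * B) ^ 2 * (ν.restrict K).real {x | 4 * B ≤ ‖T x‖} ≤ B ^ 2 * ν.real K :=
        (mul_le_mul_of_nonneg_left hsub (by positivity)).trans (hmk.trans hi)
      refine le_of_mul_le_mul_left ?_ (show 0 < (4 * B) ^ 2 by positivity)
      linarith
    have huniv : (ν.restrict K).real Set.univ = ν.real K := by simp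
    have hρ : (ν.restrict K).real {x | 4 * B ≤ ‖T x‖} ≤
        Real.exp (-2) * (ν.restrict K).real {x | ‖T x‖ ≤ 4 * B} := by
      have hsub : (ν.restrict K).real {x | 4 * B ≤ ‖T x‖}ᶜ ≤
          (ν.restrict K).real {x | ‖T x‖ ≤ 4 * B} :=
        measureReal_mono fun x hx => le_of_lt (not_le.1 (show ¬ 4 * B ≤ ‖T x‖ from hx))
      rw [measureReal_compl (hm _), huniv] at hsub
      have h9 : (1 / 9 : ℝ) ≤ Real.exp (-2) := by
        have h3 := Real.exp_one_lt_three
        have h2 : Real.exp 2 ≤ 9 := by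
          rw [show (2 : ℝ) = 1 + 1 by norm_num, Real.exp_add]
          nlinarith [Real.exp_pos 1]
        rw [Real.exp_neg, ← one_div]
        exact one_div_le_one_div_of_le (Real.exp_pos _) h2
      nlinarith
    have hmain := (h.restrict hK hconv).setIntegral_norm_pow_le T hs0 (Real.exp_pos _) le_rfl hρ
      ((one_le_div hs0).2 hts) 2
    rw [div_mul_cancel₀ _ hs0.ne', ← Real.exp_mul, huniv, Measure.restrict_restrict (hm _)] at hmain
    calc ∫ x in K ∩ {x | t ≤ x i}, x i ^ 2 ∂ν
        ≤ ∫ x in {x | t ≤ ‖T x‖} ∩ K, x i ^ 2 ∂ν :=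
          setIntegral_mono_set hint.integrableOn
            (Filter.Eventually.of_forall fun x => sq_nonneg _)
            (Filter.Eventually.of_forall fun x hx =>
              ⟨le_trans (show t ≤ x i from hx.2) (le_abs_self _), hx.1⟩)
      _ = ∫ x in {x | t ≤ ‖T x‖} ∩ K, ‖T x‖ ^ 2 ∂ν := by simp_rw [hTx, sq_abs]
      _ ≤ _ := hmain
      _ = truncatedMomentConst 2 * (t ^ 2 * Real.exp (-t / (4 * B))) * ν.real K := by
          rw [show -2 * (t / (4 * B) / 2) = -t / (4 * B) by ring]
          ring
      _ ≤ _ := by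
          have : 0 ≤ 3 * B ^ 2 * (t ^ 2 * Real.exp (-t / (4 * B))) * ν.real K := by
            positivity
          linarith

theorem exists_sum_setIntegral_coord_sq_le : ∃ C : ℝ, 0 < C ∧
    ∀ (n : ℕ) (ν : Measure (EuclideanSpace ℝ (Fin n))), IsProbabilityMeasure ν →
    LogConcaveMeasure ν → ∀ (σ p : ℝ), 0 ≤ σ → 1 ≤ p → (∀ i, ∫ x, x i ^ 2 ∂ν ≤ 1) →
    (∀ v : EuclideanSpace ℝ (Fin n), ‖v‖ ≤ 1 → ∫ x, |⟪v, x⟫| ^ p ∂ν ≤ σ ^ p) →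
    ∀ K : Set (EuclideanSpace ℝ (Fin n)), IsClosed K → Convex ℝ K → Real.exp (-p) ≤ ν.real K →
    ∀ t : ℝ, 1 ≤ t →
      ∑ i, ∫ x in K ∩ {x | t ≤ x i}, x i ^ 2 ∂ν ≤
        C * ν.real K * (σ ^ 2 + n * t ^ 2 * Real.exp (-t / C)) := by
  have hc := truncatedMomentConst_nonneg 2
  set D := (1 + truncatedMomentConst 2) * (2 * 4608 ^ 8) with hD
  have hD0 : 0 < D := by positivity
  set B := √(2 * D) with hB
  have hB0 : 0 < B := Real.sqrt_pos.2 (by positivity)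
  have hB2 : B ^ 2 = 2 * D := Real.sq_sqrt (by positivity)
  set C := truncatedMomentConst 2 + 3 * B ^ 2 + 4 * B with hCdef
  have hC0 : 0 < C := by positivity
  refine ⟨C, hC0, ?_⟩
  intro n ν hν h σ p hσ hp hmom hσp K hK hconv hKp t ht
  have hNK : 0 < ν.real K := (Real.exp_pos _).trans_le hKp
  set I := Finset.univ.filter fun i => 2 * D * ν.real K ≤ ∫ x in K, x i ^ 2 ∂ν with hI
  have hlarge : ∑ i ∈ I, ∫ x in K ∩ {x | t ≤ x i}, x i ^ 2 ∂ν ≤ 2 * D * σ ^ 2 * ν.real K := by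
    have h1 := h.sum_setIntegral_coord_sq_le hσ hp hmom hσp hK.measurableSet hKp I
    rw [← hD] at h1
    have h2 : (I.card : ℝ) * (2 * D * ν.real K) ≤ ∑ i ∈ I, ∫ x in K, x i ^ 2 ∂ν := by
      rw [← nsmul_eq_mul]
      exact Finset.card_nsmul_le_sum _ _ _ fun i hi => (Finset.mem_filter.1 hi).2
    have h3 : ∑ i ∈ I, ∫ x in K ∩ {x | t ≤ x i}, x i ^ 2 ∂ν ≤
        ∑ i ∈ I, ∫ x in K, x i ^ 2 ∂ν :=
      Finset.sum_le_sum fun i _ => setIntegral_mono_set (h.integrable_coord_sq i).integrableOn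
        (Filter.Eventually.of_forall fun x => sq_nonneg _)
        (Filter.Eventually.of_forall fun x hx => hx.1)
    nlinarith
  have hsmall : ∑ i ∈ Iᶜ, ∫ x in K ∩ {x | t ≤ x i}, x i ^ 2 ∂ν ≤
      n * ((truncatedMomentConst 2 + 3 * B ^ 2) * (t ^ 2 * Real.exp (-t / (4 * B))) * ν.real K) := by
    refine (Finset.sum_le_card_nsmul _ _ _ fun i hi =>
      h.setIntegral_coord_sq_le hK hconv hB0 i ?_ ht).trans ?_
    · rw [hB2]
      have : ¬ 2 * D * ν.real K ≤ ∫ x in K, x i ^ 2 ∂ν := by simpa [hI] using hi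
      exact (not_le.1 this).le
    · rw [nsmul_eq_mul]
      gcongr
      exact (Finset.card_le_univ _).trans_eq (Fintype.card_fin n)
  have hexp : Real.exp (-t / (4 * B)) ≤ Real.exp (-t / C) := by
    rw [Real.exp_le_exp, neg_div, neg_div, neg_le_neg_iff]
    gcongr
    rw [hCdef]
    have : 0 ≤ truncatedMomentConst 2 + 3 * B ^ 2 := by positivity
    linarith
  calc ∑ i, ∫ x in K ∩ {x | t ≤ x i}, x i ^ 2 ∂ν
      = ∑ i ∈ I, ∫ x in K ∩ {x | t ≤ x i}, x i ^ 2 ∂ν +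
        ∑ i ∈ Iᶜ, ∫ x in K ∩ {x | t ≤ x i}, x i ^ 2 ∂ν := (Finset.sum_add_sum_compl _ _).symm
    _ ≤ 2 * D * σ ^ 2 * ν.real K +
        n * ((truncatedMomentConst 2 + 3 * B ^ 2) * (t ^ 2 * Real.exp (-t / (4 * B))) *
          ν.real K) := add_le_add hlarge hsmall
    _ ≤ C * σ ^ 2 * ν.real K + n * (C * (t ^ 2 * Real.exp (-t / C)) * ν.real K) := by
        gcongr
        · rw [hCdef, hB2]; linarith
        · rw [hCdef]; linarith
    _ = _ := by ring

end Coordinates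

end LogConcaveMeasure

section RandomVector

variable {n : ℕ} {μ : Measure Ω} {X : Ω → EuclideanSpace ℝ (Fin n)}

theorem IsLogConcave.logConcaveMeasure_map [IsFiniteMeasure μ] (hX : Measurable X)
    (h : IsLogConcave μ X) : LogConcaveMeasure (μ.map X) := by
  intro K L M hK hL hM a ha ha1 hKLM
  have hmap {S : Set (EuclideanSpace ℝ (Fin n))} (hS : MeasurableSet S) :
      (μ.map X).real S = (μ (X ⁻¹' S)).toReal := map_measureReal_apply hX hS
  have hlim {S : Set (EuclideanSpace ℝ (Fin n))} (hS : IsClosed S) {b : ℝ} (hb : 0 < b) :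
      Filter.Tendsto (fun j : ℕ => (μ.map X).real (S ∩ Metric.closedBall 0 j) ^ b)
        Filter.atTop (nhds ((μ.map X).real S ^ b)) := by
    have hmono : Monotone fun j : ℕ => S ∩ Metric.closedBall 0 (j : ℝ) := fun i j hij =>
      Set.inter_subset_inter_right _ (Metric.closedBall_subset_closedBall (Nat.cast_le.2 hij))
    have h1 := tendsto_measure_iUnion_atTop (μ := μ.map X) hmono
    rw [← Set.inter_iUnion, Metric.iUnion_closedBall_nat, Set.inter_univ] at h1
    exact ((ENNReal.tendsto_toReal (measure_ne_top _ _)).comp h1).rpow_const (Or.inr hb.le)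
  refine le_of_tendsto ((hlim hK ha).mul (hlim hL (sub_pos.2 ha1)))
    (Filter.Eventually.of_forall fun j => ?_)
  rcases (K ∩ Metric.closedBall 0 (j : ℝ)).eq_empty_or_nonempty with hKj | hKj
  · rw [hKj, measureReal_empty, Real.zero_rpow ha.ne', zero_mul]
    exact measureReal_nonneg
  rcases (L ∩ Metric.closedBall 0 (j : ℝ)).eq_empty_or_nonempty with hLj | hLj
  · rw [hLj, measureReal_empty, Real.zero_rpow (sub_pos.2 ha1).ne', mul_zero]
    exact measureReal_nonneg
  have hcK := (isCompact_closedBall (0 : EuclideanSpace ℝ (Fin n)) j).inter_left hK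
  have hcL := (isCompact_closedBall (0 : EuclideanSpace ℝ (Fin n)) j).inter_left hL
  rw [hmap hcK.measurableSet, hmap hcL.measurableSet, hmap hM]
  refine (h _ _ hKj hLj hcK hcL a ha.le ha1.le).trans
    (ENNReal.toReal_mono (measure_ne_top _ _) (measure_mono (Set.preimage_mono ?_)))
  rintro _ ⟨_, ⟨x, hx, rfl⟩, _, ⟨y, hy, rfl⟩, rfl⟩
  exact hKLM x hx.1 y hy.1

theorem IsIsotropic.map_ne_ne_zero [IsProbabilityMeasure μ] (hX : Measurable X)
    (h : LogConcaveMeasure (μ.map X)) (hiso : IsIsotropic μ X)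
    (f : EuclideanSpace ℝ (Fin n) →L[ℝ] ℝ) (c : ℝ) (hf : f ≠ 0) :
    (μ.map X) {x | f x ≠ c} ≠ 0 := by
  intro h0
  have : IsProbabilityMeasure (μ.map X) := Measure.isProbabilityMeasure_map hX.aemeasurable
  have hae : ∀ᵐ x ∂(μ.map X), f x = c := h0
  have hfx (x : EuclideanSpace ℝ (Fin n)) :
      f x = ∑ i, f (EuclideanSpace.single i 1) * x i := by
    conv_lhs => rw [← (EuclideanSpace.basisFun (Fin n) ℝ).sum_repr x]
    simp [mul_comm]
  have hi (i : Fin n) : Integrable (fun x : EuclideanSpace ℝ (Fin n) => x i) (μ.map X) := by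
    have := h.integrable_norm_pow 1
    simp only [pow_one] at this
    exact this.mono' (by fun_prop) (Filter.Eventually.of_forall fun x => PiLp.norm_apply_le x i)
  have hij (i j : Fin n) :
      Integrable (fun x : EuclideanSpace ℝ (Fin n) => x i * x j) (μ.map X) := by
    refine (h.integrable_norm_pow 2).mono' (by fun_prop) (Filter.Eventually.of_forall fun x => ?_)
    rw [norm_mul, sq]
    exact mul_le_mul (PiLp.norm_apply_le x i) (PiLp.norm_apply_le x j) (norm_nonneg _)
      (norm_nonneg _)
  have hmean (i : Fin n) : ∫ x, x i ∂(μ.map X) = 0 := by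
    rw [integral_map hX.aemeasurable (by fun_prop)]
    exact hiso.1 i
  have hcov (i j : Fin n) : ∫ x, x i * x j ∂(μ.map X) = if i = j then 1 else 0 := by
    rw [integral_map hX.aemeasurable (by fun_prop)]
    exact hiso.2 i j
  refine hf (ContinuousLinearMap.ext fun x => ?_)
  rw [hfx, zero_apply]
  refine Finset.sum_eq_zero fun j _ => ?_
  have h1 : ∫ x, f x * x j ∂(μ.map X) = f (EuclideanSpace.single j 1) := by
    have hsum : (fun x => f x * x j) =
        fun x => ∑ i, f (EuclideanSpace.single i 1) * (x i * x j) := by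
      ext x
      rw [hfx x, Finset.sum_mul]
      simp only [mul_assoc]
    rw [hsum, integral_finsetSum _ fun i _ => (hij i j).const_mul _]
    simp_rw [integral_const_mul, hcov]
    simp
  have h2 : ∫ x, f x * x j ∂(μ.map X) = 0 := by
    have : (fun x => f x * x j) =ᵐ[μ.map X] fun x => c * x j := by
      filter_upwards [hae] with x hx
      rw [hx]
    rw [integral_congr_ae this, integral_const_mul, hmean, mul_zero]
  rw [h1.symm.trans h2, zero_mul]

theorem integral_abs_inner_rpow_le_sigmaX [IsProbabilityMeasure μ] (hX : Measurable X)
    (h : LogConcaveMeasure (μ.map X)) {p : ℝ} (hp : 1 ≤ p) (v : EuclideanSpace ℝ (Fin n))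
    (hv : ‖v‖ ≤ 1) : ∫ x, |⟪v, x⟫| ^ p ∂(μ.map X) ≤ sigmaX μ X p ^ p := by
  have hp0 : 0 < p := by linarith
  have : IsProbabilityMeasure (μ.map X) := Measure.isProbabilityMeasure_map hX.aemeasurable
  have hmap (u : EuclideanSpace ℝ (Fin n)) :
      ∫ x, |⟪u, x⟫| ^ p ∂(μ.map X) = ∫ ω, |⟪u, X ω⟫| ^ p ∂μ :=
    integral_map hX.aemeasurable ((continuous_const.inner continuous_id').abs.rpow_const
      fun _ => Or.inr hp0.le).measurable.aestronglyMeasurable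
  have hbdd : BddAbove (Set.range fun u : {u : EuclideanSpace ℝ (Fin n) // ‖u‖ = 1} =>
      (∫ ω, |⟪u.1, X ω⟫| ^ p ∂μ) ^ (1 / p)) := by
    refine ⟨(∫ x, ‖x‖ ^ p ∂(μ.map X)) ^ (1 / p), ?_⟩
    rintro _ ⟨u, rfl⟩
    dsimp only
    rw [← hmap]
    refine Real.rpow_le_rpow (integral_nonneg fun x => by positivity) ?_ (by positivity)
    refine integral_mono (h.integrable_abs_inner_rpow u.1 hp0.le) (h.integrable_norm_rpow hp0.le)
      fun x => (abs_inner_rpow_le u.1 x hp0.le).trans_eq ?_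
    rw [u.2, Real.one_rpow, one_mul]
  have hnn : 0 ≤ sigmaX μ X p := Real.iSup_nonneg fun u => by positivity
  have hunit (u : EuclideanSpace ℝ (Fin n)) (hu : ‖u‖ = 1) :
      ∫ x, |⟪u, x⟫| ^ p ∂(μ.map X) ≤ sigmaX μ X p ^ p := by
    have hle := le_ciSup hbdd ⟨u, hu⟩
    have hI : 0 ≤ ∫ ω, |⟪u, X ω⟫| ^ p ∂μ := integral_nonneg fun x => by positivity
    calc ∫ x, |⟪u, x⟫| ^ p ∂(μ.map X) = ((∫ ω, |⟪u, X ω⟫| ^ p ∂μ) ^ (1 / p)) ^ p := by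
          rw [hmap, ← Real.rpow_mul hI, one_div_mul_cancel hp0.ne', Real.rpow_one]
      _ ≤ _ := Real.rpow_le_rpow (by positivity) hle hp0.le
  rcases eq_or_ne v 0 with rfl | hv0
  · simp only [inner_zero_left, abs_zero, Real.zero_rpow hp0.ne', integral_zero]
    positivity
  have hvn : 0 < ‖v‖ := norm_pos_iff.2 hv0
  have hu : ‖‖v‖⁻¹ • v‖ = 1 := by rw [norm_smul, norm_inv, norm_norm, inv_mul_cancel₀ hvn.ne']
  refine le_trans (integral_mono (h.integrable_abs_inner_rpow v hp0.le)
    (h.integrable_abs_inner_rpow (‖v‖⁻¹ • v) hp0.le) fun x => ?_) (hunit _ hu)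
  refine Real.rpow_le_rpow (abs_nonneg _) ?_ hp0.le
  rw [real_inner_smul_left, abs_mul, abs_of_pos (inv_pos.2 hvn)]
  exact le_mul_of_one_le_left (abs_nonneg _) ((one_le_inv₀ hvn).2 hv)

end RandomVector

/-- **Proposition (conditional estimate, part 1).** There is a universal constant `C > 0` such
that for every isotropic log-concave random vector `X` in `ℝⁿ`, every convex set `K ⊆ ℝⁿ`
with `A = {X ∈ K}` satisfying `0 < P(A) ≤ 1/e`, and every `t ≥ 1`,
`∑ᵢ E[Xᵢ² 𝟙_{A ∩ {Xᵢ ≥ t}}] ≤ C·P(A)·(σ_X(−log P(A))² + n·t²·e^{−t/C})`. -/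
theorem conditional_second_moment :
    ∃ C : ℝ, 0 < C ∧
      ∀ (Ω : Type) (_ : MeasurableSpace Ω) (μ : Measure Ω), IsProbabilityMeasure μ →
      ∀ (n : ℕ) (X : Ω → EuclideanSpace ℝ (Fin n)), Measurable X →
      IsLogConcave μ X → IsIsotropic μ X →
      ∀ K : Set (EuclideanSpace ℝ (Fin n)), Convex ℝ K →
        0 < (μ (X ⁻¹' K)).toReal → (μ (X ⁻¹' K)).toReal ≤ 1 / Real.exp 1 →
      ∀ t : ℝ, 1 ≤ t →
        ∑ i, ∫ ω, (if X ω ∈ K ∧ t ≤ X ω i then (X ω i) ^ 2 else 0) ∂μ ≤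
          C * (μ (X ⁻¹' K)).toReal *
            ((sigmaX μ X (-Real.log (μ (X ⁻¹' K)).toReal)) ^ 2 +
              (n : ℝ) * t ^ 2 * Real.exp (-t / C)) := by
  obtain ⟨C, hC, hmain⟩ := LogConcaveMeasure.exists_sum_setIntegral_coord_sq_le
  refine ⟨C, hC, ?_⟩
  intro Ω _ μ hμ n X hX hlc hiso K hK hpos hle t ht
  have h := hlc.logConcaveMeasure_map hX
  have hν : IsProbabilityMeasure (μ.map X) := Measure.isProbabilityMeasure_map hX.aemeasurable
  have hfr : (μ.map X) (frontier K) = 0 :=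
    h.measure_frontier_eq_zero (fun f c hf => hiso.map_ne_ne_zero hX h f c hf) hK
  rw [Measure.map_apply hX isClosed_frontier.measurableSet] at hfr
  have hiff : ∀ᵐ ω ∂μ, (X ω ∈ K ↔ X ω ∈ closure K) := by
    filter_upwards [measure_eq_zero_iff_ae_notMem.1 hfr] with ω hω
    refine ⟨fun hx => subset_closure hx, fun hx => ?_⟩
    by_contra hxK
    exact hω ⟨hx, fun hxi => hxK (interior_subset hxi)⟩
  have hcl : MeasurableSet (closure K) := isClosed_closure.measurableSet
  have hKcl : (μ (X ⁻¹' K)).toReal = (μ.map X).real (closure K) := by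
    rw [measureReal_def, Measure.map_apply hX hcl]
    exact congrArg ENNReal.toReal (measure_congr (Filter.eventuallyEq_set.2 hiff))
  rw [hKcl] at hpos hle ⊢
  have hp : 1 ≤ -Real.log ((μ.map X).real (closure K)) := by
    have := Real.log_le_log hpos hle
    rw [one_div, Real.log_inv, Real.log_exp] at this
    linarith
  have hmom (i : Fin n) : ∫ x, x i ^ 2 ∂(μ.map X) ≤ 1 := by
    rw [integral_map hX.aemeasurable (by fun_prop)]
    have := hiso.2 i i
    simp only [if_true, ← sq] at this
    exact this.le
  have hsum := hmain n (μ.map X) hν h (sigmaX μ X (-Real.log ((μ.map X).real (closure K)))) _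
    (Real.iSup_nonneg fun u => Real.rpow_nonneg (integral_nonneg fun x => by positivity) _) hp hmom
    (fun v hv => integral_abs_inner_rpow_le_sigmaX hX h hp v hv) (closure K) isClosed_closure
    hK.closure (by rw [neg_neg, Real.exp_log hpos]) t ht
  refine le_trans (Finset.sum_le_sum fun i _ => ?_) hsum
  have hS : MeasurableSet (closure K ∩ {x : EuclideanSpace ℝ (Fin n) | t ≤ x i}) :=
    hcl.inter (isClosed_le continuous_const (by fun_prop)).measurableSet
  rw [setIntegral_map hS (by fun_prop) hX.aemeasurable, ← integral_indicator (hX hS)]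
  refine (integral_congr_ae ?_).le
  filter_upwards [hiff] with ω hω
  rw [hω, Set.indicator_apply]
  exact if_congr Iff.rfl rfl rfl

end
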